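/- arXiv:1807.11273 — 5 statements merged into one kernel-verified Lean document; each statement's English description precedes it below -/
import Mathlib

section
/- Weak Three Gap Theorem: for every irrational z ∈ (0,1) and every integer N ≥ 2, the gaps of P_N take at most three distinct values. -/
open Finset Filter

/-- The first `N` points of the Kronecker sequence: `P_N = {{n z} : 0 ≤ n ≤ N - 1}`. -/
noncomputable def kroneckerPts (z : ℝ) (N : ℕ) : Finset ℝ :=
  (Finset.range N).image fun n : ℕ => Int.fract ((n : ℝ) * z)

open Classical in
/-- The gap of the finite set `S ⊆ [0,1)` at the point `x`: the distance to the next point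
of `S` to the right of `x`, with the wrap-around gap `1 - x` at the rightmost point
(note that `0 ∈ kroneckerPts z N`, so this is the arc length to the next point on `ℝ/ℤ`). -/
noncomputable def gapOf (S : Finset ℝ) (x : ℝ) : ℝ :=
  if h : (S.filter fun y => x < y).Nonempty then (S.filter fun y => x < y).min' h - x
  else 1 - x

open Classical in
/-- The set of distinct gap lengths of `S`. -/
noncomputable def gapValues (S : Finset ℝ) : Finset ℝ :=
  S.image (gapOf S)

open Classical in
/-- The number of gaps of `S` having length `L`. -/
noncomputable def gapCount (S : Finset ℝ) (L : ℝ) : ℕ :=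
  (S.filter fun x => gapOf S x = L).card

/-- The length in `(0, 1]` of the positively oriented arc from `0` to `k * z` on `ℝ/ℤ`. -/
noncomputable def arcLength (z : ℝ) (k : ℤ) : ℝ := 1 - Int.fract (-((k : ℝ) * z))

theorem arcLength_pos (z : ℝ) (k : ℤ) : 0 < arcLength z k :=
  sub_pos.2 (Int.fract_lt_one _)

theorem arcLength_le_one (z : ℝ) (k : ℤ) : arcLength z k ≤ 1 :=
  sub_le_self _ (Int.fract_nonneg _)

theorem exists_arcLength_eq (z : ℝ) (k : ℤ) : ∃ j : ℤ, arcLength z k = k * z + j := by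
  refine ⟨1 + ⌊-((k : ℝ) * z)⌋, ?_⟩
  rw [arcLength, Int.fract]
  push_cast
  ring

theorem arcLength_eq {z t : ℝ} {k : ℤ} (j : ℤ) (h0 : 0 < t) (h1 : t ≤ 1) (h : t = k * z + j) :
    arcLength z k = t := by
  have : Int.fract (-((k : ℝ) * z)) = 1 - t :=
    Int.fract_eq_iff.2 ⟨by linarith, by linarith, j - 1, by push_cast; linarith⟩
  rw [arcLength, this]
  ring

theorem arcLength_add {z : ℝ} {k l : ℤ} (h : arcLength z k + arcLength z l ≤ 1) :
    arcLength z (k + l) = arcLength z k + arcLength z l := by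
  obtain ⟨i, hi⟩ := exists_arcLength_eq z k
  obtain ⟨j, hj⟩ := exists_arcLength_eq z l
  refine arcLength_eq (i + j) (add_pos (arcLength_pos z k) (arcLength_pos z l)) h ?_
  rw [hi, hj]
  push_cast
  ring

theorem arcLength_sub {z : ℝ} {k l : ℤ} (h : arcLength z l < arcLength z k) :
    arcLength z (k - l) = arcLength z k - arcLength z l := by
  obtain ⟨i, hi⟩ := exists_arcLength_eq z k
  obtain ⟨j, hj⟩ := exists_arcLength_eq z l
  refine arcLength_eq (i - j) (sub_pos.2 h)
    (by linarith [arcLength_le_one z k, arcLength_pos z l]) ?_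
  rw [hi, hj]
  push_cast
  ring

theorem arcLength_lt_one {z : ℝ} (hz : Irrational z) {k : ℤ} (hk : k ≠ 0) :
    arcLength z k < 1 := by
  refine lt_of_le_of_ne (arcLength_le_one z k) fun h => ?_
  obtain ⟨j, hj⟩ := exists_arcLength_eq z k
  refine (hz.intCast_mul hk).ne_int (1 - j) ?_
  push_cast
  linarith

theorem arcLength_injective {z : ℝ} (hz : Irrational z) : Function.Injective (arcLength z) := by
  intro k l h
  obtain ⟨i, hi⟩ := exists_arcLength_eq z k
  obtain ⟨j, hj⟩ := exists_arcLength_eq z l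
  by_contra hkl
  refine (hz.intCast_mul (sub_ne_zero.2 hkl)).ne_int (j - i) ?_
  push_cast
  linarith

theorem arcLength_zero (z : ℝ) : arcLength z 0 = 1 := by
  simp [arcLength]

theorem arcLength_neg {z : ℝ} (hz : Irrational z) {k : ℤ} (hk : k ≠ 0) :
    arcLength z (-k) = 1 - arcLength z k := by
  rw [← zero_sub, arcLength_sub (by rw [arcLength_zero]; exact arcLength_lt_one hz hk),
    arcLength_zero]

theorem arcLength_fract_sub (z : ℝ) (m n : ℕ) :
    (Int.fract (n * z) < Int.fract (m * z) →
      arcLength z (m - n) = Int.fract (m * z) - Int.fract (n * z)) ∧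
    (Int.fract (m * z) ≤ Int.fract (n * z) →
      arcLength z (m - n) = Int.fract (m * z) - Int.fract (n * z) + 1) := by
  have hm := Int.fract_nonneg ((m : ℝ) * z)
  have hn := Int.fract_nonneg ((n : ℝ) * z)
  have hm' := Int.fract_lt_one ((m : ℝ) * z)
  have hn' := Int.fract_lt_one ((n : ℝ) * z)
  constructor <;> intro h
  · refine arcLength_eq (⌊(n : ℝ) * z⌋ - ⌊(m : ℝ) * z⌋) (by linarith) (by linarith) ?_
    rw [Int.fract, Int.fract]
    push_cast
    ring
  · refine arcLength_eq (⌊(n : ℝ) * z⌋ - ⌊(m : ℝ) * z⌋ + 1) (by linarith) (by linarith) ?_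
    rw [Int.fract, Int.fract]
    push_cast
    ring

/-- The gap at `{nz}` is the length of the shortest arc from `{nz}` to a point of `P_N`. -/
theorem isLeast_gapOf_kroneckerPts (z : ℝ) {N n : ℕ} (hn : n < N) :
    IsLeast {t | ∃ m < N, arcLength z (m - n) = t}
      (gapOf (kroneckerPts z N) (Int.fract (n * z))) := by
  classical
  have mem {m : ℕ} (hm : m < N) : Int.fract ((m : ℝ) * z) ∈ kroneckerPts z N :=
    Finset.mem_image_of_mem _ (Finset.mem_range.2 hm)
  unfold gapOf
  split_ifs with h
  · have hmin := Finset.min'_mem _ h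
    rw [Finset.mem_filter] at hmin
    obtain ⟨hS, hlt⟩ := hmin
    obtain ⟨m, hm, hmeq⟩ := Finset.mem_image.1 hS
    refine ⟨⟨m, Finset.mem_range.1 hm, ?_⟩, ?_⟩
    · rw [← hmeq] at hlt ⊢
      exact (arcLength_fract_sub z m n).1 hlt
    · rintro _ ⟨k, hk, rfl⟩
      rcases lt_or_ge (Int.fract ((n : ℝ) * z)) (Int.fract (k * z)) with hlt' | hle
      · rw [(arcLength_fract_sub z k n).1 hlt']
        exact sub_le_sub_right
          (Finset.min'_le _ _ (Finset.mem_filter.2 ⟨mem hk, hlt'⟩)) _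
      · rw [(arcLength_fract_sub z k n).2 hle, ← hmeq]
        linarith [Int.fract_lt_one ((m : ℝ) * z), Int.fract_nonneg ((k : ℝ) * z)]
  · refine ⟨⟨0, by omega, ?_⟩, ?_⟩
    · rw [(arcLength_fract_sub z 0 n).2 (by simp [Int.fract_nonneg])]
      simp
      ring
    · rintro _ ⟨k, hk, rfl⟩
      have hle : Int.fract ((k : ℝ) * z) ≤ Int.fract (n * z) := not_lt.1 fun hlt =>
        h ⟨_, Finset.mem_filter.2 ⟨mem hk, hlt⟩⟩
      rw [(arcLength_fract_sub z k n).2 hle]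
      linarith [Int.fract_nonneg ((k : ℝ) * z)]

/-- If `α` and `β` are the shortest arcs from `0` to `a * z` and to `-b * z` with
`1 ≤ a, b ≤ N - 1`, then every gap of `P_N` is `α`, `β` or `α + β`. -/
theorem isLeast_arcLength_eq {z : ℝ} (hz : Irrational z) {N n : ℕ} (hN : 2 ≤ N) (hn : n < N)
    {a b : ℤ} (ha : a ∈ Finset.Ico (1 : ℤ) N) (hb : b ∈ Finset.Ico (1 : ℤ) N)
    (hamin : ∀ k ∈ Finset.Ico (1 : ℤ) N, arcLength z a ≤ arcLength z k)
    (hbmin : ∀ k ∈ Finset.Ico (1 : ℤ) N, arcLength z (-b) ≤ arcLength z (-k))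
    {g : ℝ} (hg : IsLeast {t | ∃ m < N, arcLength z (m - n) = t} g) :
    g = arcLength z a ∨ g = arcLength z (-b) ∨ g = arcLength z a + arcLength z (-b) := by
  rw [Finset.mem_Ico] at ha hb
  simp only [Finset.mem_Ico] at hamin hbmin
  obtain ⟨⟨m, hm, rfl⟩, hmin⟩ := hg
  have hle (d : ℤ) (h0 : 0 ≤ n + d) (h1 : n + d < N) :
      arcLength z (m - n) ≤ arcLength z d :=
    hmin ⟨(n + d).toNat, by omega, by rw [Int.toNat_of_nonneg h0, add_sub_cancel_left]⟩
  obtain ⟨d, hd⟩ : ∃ d : ℤ, d = m - n := ⟨_, rfl⟩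
  rw [← hd] at hle ⊢
  have hd0 : d ≠ 0 := by
    rintro rfl
    rw [arcLength_zero] at hle
    by_cases h : n = 0
    · exact (hle 1 (by omega) (by omega)).not_gt (arcLength_lt_one hz one_ne_zero)
    · exact (hle (-1) (by omega) (by omega)).not_gt (arcLength_lt_one hz (by norm_num))
  by_cases hna : n + a < N
  · left
    refine (hle a (by omega) hna).antisymm ?_
    rcases hd0.lt_or_gt with hneg | hpos
    · by_contra! hlt
      have := hamin (a - d) (by omega)
      rw [arcLength_sub hlt] at this
      linarith [arcLength_pos z d]
    · exact hamin d (by omega)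
  by_cases hnb : b ≤ n
  · right; left
    refine (hle (-b) (by omega) (by omega)).antisymm ?_
    rcases hd0.lt_or_gt with hneg | hpos
    · simpa using hbmin (-d) (by omega)
    · by_contra! hlt
      have := hbmin (b + d) (by omega)
      rw [neg_add', arcLength_sub hlt] at this
      linarith [arcLength_pos z d]
  right; right
  have hsum : arcLength z a + arcLength z (-b) ≤ 1 := by
    have := hbmin a ha
    rw [arcLength_neg hz (by omega : a ≠ 0)] at this
    linarith
  refine le_antisymm ?_ ?_
  · rw [← arcLength_add hsum]
    exact hle _ (by omega) (by omega)
  rcases hd0.lt_or_gt with hneg | hpos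
  · have hbd : arcLength z (-b) ≤ arcLength z d := by simpa using hbmin (-d) (by omega)
    by_contra! hlt
    rcases hbd.lt_or_eq with h | h
    · have := hamin (d - -b) (by omega)
      rw [arcLength_sub h] at this
      linarith
    · have := arcLength_injective hz h
      omega
  · have had := hamin d (by omega)
    by_contra! hlt
    rcases had.lt_or_eq with h | h
    · have := hbmin (a - d) (by omega)
      rw [neg_sub, arcLength_sub h] at this
      linarith
    · have := arcLength_injective hz h
      omega

/-- **Weak Three Gap Theorem.** For every irrational `z ∈ (0,1)` and every `N ≥ 2`,
the gaps of `P_N` take at most three distinct values. -/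
theorem weak_three_gap_theorem
    (z : ℝ) (hirr : Irrational z) (hz0 : 0 < z) (hz1 : z < 1)
    (N : ℕ) (hN2 : 2 ≤ N) :
    (gapValues (kroneckerPts z N)).card ≤ 3 := by
  classical
  have hne : (Finset.Ico (1 : ℤ) N).Nonempty := ⟨1, Finset.mem_Ico.2 (by omega)⟩
  obtain ⟨a, ha, hamin⟩ := Finset.exists_min_image _ (arcLength z) hne
  obtain ⟨b, hb, hbmin⟩ := Finset.exists_min_image _ (fun k => arcLength z (-k)) hne
  refine (Finset.card_le_card (t := {arcLength z a, arcLength z (-b),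
    arcLength z a + arcLength z (-b)}) ?_).trans Finset.card_le_three
  intro g hg
  obtain ⟨x, hx, rfl⟩ := Finset.mem_image.1 hg
  obtain ⟨n, hn, rfl⟩ := Finset.mem_image.1 hx
  rw [Finset.mem_range] at hn
  simpa only [Finset.mem_insert, Finset.mem_singleton] using
    isLeast_arcLength_eq hirr hN2 hn ha hb hamin hbmin (isLeast_gapOf_kroneckerPts z hn)
end

section
/- If for some irrational z ∈ (0,1) and N ≥ 2 the gaps of P_N take exactly three distinct values ℓ₁ < ℓ₂ < ℓ₃, then the largest is the sum of the other two: ℓ₃ = ℓ₁ + ℓ₂. -/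
open Finset Filter

theorem fract_sub_eq_of_fract_le {x y : ℝ} (h : Int.fract y ≤ Int.fract x) :
    Int.fract (x - y) = Int.fract x - Int.fract y := by
  rw [Int.fract_eq_iff]
  refine ⟨by linarith, by linarith [Int.fract_lt_one x, Int.fract_nonneg y], ⌊x⌋ - ⌊y⌋, ?_⟩
  push_cast [Int.fract]
  ring

theorem fract_add_eq_of_add_lt_one {x y : ℝ} (h : Int.fract x + Int.fract y < 1) :
    Int.fract (x + y) = Int.fract x + Int.fract y := by
  rw [Int.fract_eq_iff]
  refine ⟨by linarith [Int.fract_nonneg x, Int.fract_nonneg y], h, ⌊x⌋ + ⌊y⌋, ?_⟩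
  push_cast [Int.fract]
  ring

theorem fract_sub_eq_of_fract_lt {x y : ℝ} (h : Int.fract x < Int.fract y) :
    Int.fract (x - y) = 1 + Int.fract x - Int.fract y := by
  rw [Int.fract_eq_iff]
  refine ⟨by linarith [Int.fract_lt_one y, Int.fract_nonneg x], by linarith,
    ⌊x⌋ - ⌊y⌋ - 1, ?_⟩
  push_cast [Int.fract]
  ring

theorem fract_intCast_mul_pos {z : ℝ} (hz : Irrational z) {d : ℤ} (hd : d ≠ 0) :
    0 < Int.fract ((d : ℝ) * z) :=
  Int.fract_pos.2 ((hz.intCast_mul hd).ne_int _)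

/-- If `v > 0` is the least circular distance to the right from the point `{n z}` to another
point of `P_N`, then it is the gap of `P_N` at that point. -/
theorem gapOf_kroneckerPts_eq {z v : ℝ} {N n : ℕ} (hn : n < N) (hv : 0 < v)
    (hmem : ∃ m < N, Int.fract ((m : ℝ) * z - n * z) = v)
    (hle : ∀ m < N, m ≠ n → v ≤ Int.fract ((m : ℝ) * z - n * z)) :
    gapOf (kroneckerPts z N) (Int.fract ((n : ℝ) * z)) = v := by
  obtain ⟨m, hm, hmv⟩ := hmem
  have hm_mem : Int.fract ((m : ℝ) * z) ∈ kroneckerPts z N :=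
    Finset.mem_image.2 ⟨m, Finset.mem_range.2 hm, rfl⟩
  have hm_ne : Int.fract ((m : ℝ) * z) ≠ Int.fract ((n : ℝ) * z) := fun h => by
    rw [fract_sub_eq_of_fract_le h.ge] at hmv
    linarith
  unfold gapOf
  split_ifs with hS
  · set y := Finset.min' _ hS with hy
    obtain ⟨hyS, hny⟩ := Finset.mem_filter.1 (Finset.min'_mem _ hS)
    rw [← hy] at hyS hny
    obtain ⟨k, hk, hky⟩ := Finset.mem_image.1 hyS
    rw [Finset.mem_range] at hk
    have hkn : k ≠ n := by
      rintro rfl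
      exact hny.ne hky
    have hvy := hle k hk hkn
    rw [fract_sub_eq_of_fract_le (by rw [hky]; exact hny.le), hky] at hvy
    rcases lt_or_gt_of_ne hm_ne with h | h
    · rw [fract_sub_eq_of_fract_lt h] at hmv
      have := Int.fract_lt_one ((k : ℝ) * z)
      linarith [Int.fract_nonneg ((m : ℝ) * z)]
    · rw [fract_sub_eq_of_fract_le h.le] at hmv
      have := Finset.min'_le _ _ (Finset.mem_filter.2 ⟨hm_mem, h⟩)
      rw [← hy] at this
      linarith
  · have hmn : Int.fract ((m : ℝ) * z) < Int.fract ((n : ℝ) * z) :=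
      hm_ne.lt_of_le (not_lt.1 fun h => hS ⟨_, Finset.mem_filter.2 ⟨hm_mem, h⟩⟩)
    have hn0 : 0 < Int.fract ((n : ℝ) * z) := (Int.fract_nonneg _).trans_lt hmn
    have h0 := hle 0 (by omega) (by rintro rfl; simp at hn0)
    rw [fract_sub_eq_of_fract_lt (by simpa using hn0)] at h0
    rw [fract_sub_eq_of_fract_lt hmn] at hmv
    simp only [Nat.cast_zero, zero_mul, Int.fract_zero] at h0
    linarith [Int.fract_nonneg ((m : ℝ) * z)]

/-- Every gap of `P_N` is one of `α`, `β`, `α + β`, where `α` and `β` are the two gaps next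
to the point `0`. -/
theorem exists_gapOf_kroneckerPts_eq_or {z : ℝ} (hz : Irrational z) {N : ℕ} (hN : 2 ≤ N) :
    ∃ α β : ℝ, 0 < α ∧ 0 < β ∧ ∀ x ∈ kroneckerPts z N,
      gapOf (kroneckerPts z N) x = α ∨ gapOf (kroneckerPts z N) x = β ∨
        gapOf (kroneckerPts z N) x = α + β := by
  obtain ⟨F, hF⟩ : ∃ F : ℤ → ℝ, ∀ d, F d = Int.fract ((d : ℝ) * z) := ⟨_, fun _ => rfl⟩
  have hpos : ∀ d, d ≠ 0 → 0 < F d := fun d hd => hF d ▸ fract_intCast_mul_pos hz hd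
  have hlt : ∀ d, F d < 1 := fun d => hF d ▸ Int.fract_lt_one _
  have hsub : ∀ d e, F e ≤ F d → F (d - e) = F d - F e := fun d e h => by
    rw [hF, hF] at h
    rw [hF, hF, hF, ← fract_sub_eq_of_fract_le h, Int.cast_sub, sub_mul]
  have hadd : ∀ d e, F d + F e < 1 → F (d + e) = F d + F e := fun d e h => by
    rw [hF, hF] at h
    rw [hF, hF, hF, ← fract_add_eq_of_add_lt_one h, Int.cast_add, add_mul]
  have hne : (Finset.Ioo (0 : ℤ) N).Nonempty := ⟨1, Finset.mem_Ioo.2 ⟨by omega, by omega⟩⟩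
  obtain ⟨a, ha, hamin⟩ := Finset.exists_min_image _ F hne
  obtain ⟨b, hb, hbmin⟩ := Finset.exists_min_image _ (fun d => F (-d)) hne
  simp only [Finset.mem_Ioo] at ha hb hamin hbmin
  have hα := hpos a (by omega)
  have hβ := hpos (-b) (by omega)
  have hab : (N : ℤ) ≤ a + b := by
    by_contra! h
    rcases le_total (F (-b)) (F a) with hle | hle
    · have h1 := hsub _ _ hle
      have h2 := hamin (a - -b) ⟨by omega, by omega⟩
      linarith
    · have h1 := hsub _ _ hle
      have h2 := hbmin (a + b) ⟨by omega, by omega⟩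
      rw [show -(a + b) = -b - a by ring] at h2
      linarith
  have gap_eq : ∀ (n : ℕ) (v : ℝ), n < N → 0 < v →
      (∃ m : ℤ, 0 ≤ m ∧ m < N ∧ F (m - n) = v) →
      (∀ m : ℤ, 0 ≤ m → m < N → m ≠ n → v ≤ F (m - n)) →
      gapOf (kroneckerPts z N) (Int.fract ((n : ℝ) * z)) = v := by
    rintro n v hn hv ⟨m, hm0, hmN, hm⟩ hle
    lift m to ℕ using hm0
    refine gapOf_kroneckerPts_eq hn hv ⟨m, by omega, ?_⟩ fun k hk hkn => ?_
    · rw [← hm, hF]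
      push_cast
      rw [sub_mul]
    · have := hle k (by omega) (by omega) (by omega)
      rw [hF] at this
      push_cast at this
      rwa [sub_mul] at this
  refine ⟨F a, F (-b), hα, hβ, fun x hx => ?_⟩
  obtain ⟨n, hn, rfl⟩ := Finset.mem_image.1 hx
  rw [Finset.mem_range] at hn
  rcases lt_or_ge ((n : ℤ) + a) N with hna | hna
  · left
    refine gap_eq n _ hn hα ⟨n + a, by omega, hna, by congr 1; ring⟩ fun m hm0 hmN hmn => ?_
    rcases lt_or_gt_of_ne hmn with h | h
    · by_contra! hcon
      have h1 := hsub _ _ hcon.le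
      have h2 := hamin (a - (m - n)) ⟨by omega, by omega⟩
      linarith [hpos (m - n) (by omega)]
    · exact hamin _ ⟨by omega, by omega⟩
  rcases le_or_gt b n with hnb | hnb
  · right; left
    refine gap_eq n _ hn hβ ⟨n - b, by omega, by omega, by congr 1; ring⟩
      fun m hm0 hmN hmn => ?_
    rcases lt_or_gt_of_ne hmn with h | h
    · have := hbmin (n - m) ⟨by omega, by omega⟩
      rwa [neg_sub] at this
    · by_contra! hcon
      have h1 := hsub _ _ hcon.le
      have h2 := hbmin (b + (m - n)) ⟨by omega, by omega⟩
      rw [neg_add, ← sub_eq_add_neg] at h2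
      linarith [hpos (m - n) (by omega)]
  · right; right
    have hle : ∀ m : ℤ, 0 ≤ m → m < N → m ≠ n → F a + F (-b) ≤ F (m - n) := by
      intro m hm0 hmN hmn
      by_contra! hcon
      rcases lt_or_gt_of_ne hmn with h | h
      · have h1 := hbmin (n - m) ⟨by omega, by omega⟩
        rw [neg_sub] at h1
        have h2 := hsub _ _ h1
        have h3 := hamin (m - n - -b) ⟨by omega, by omega⟩
        linarith
      · have h1 := hamin (m - n) ⟨by omega, by omega⟩
        have h2 := hsub _ _ h1
        have h3 := hbmin (a - (m - n)) ⟨by omega, by omega⟩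
        rw [neg_sub] at h3
        linarith
    have hsum : F a + F (-b) < 1 := by
      by_cases h0 : n = 0
      · exact (hle 1 (by omega) (by omega) (by omega)).trans_lt (hlt _)
      · exact (hle 0 (by omega) (by omega) (by omega)).trans_lt (hlt _)
    refine gap_eq n _ hn (by linarith) ⟨n + a - b, by omega, by omega, ?_⟩ hle
    rw [← hadd _ _ hsum]
    congr 1
    ring

/-- If the gaps of `P_N` take exactly three distinct values `ℓ₁ < ℓ₂ < ℓ₃`,
then the largest is the sum of the other two: `ℓ₃ = ℓ₁ + ℓ₂`. -/
theorem three_gap_largest_is_sum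
    (z : ℝ) (hirr : Irrational z) (hz0 : 0 < z) (hz1 : z < 1)
    (N : ℕ) (hN2 : 2 ≤ N) (ℓ₁ ℓ₂ ℓ₃ : ℝ) (h12 : ℓ₁ < ℓ₂) (h23 : ℓ₂ < ℓ₃)
    (hvals : gapValues (kroneckerPts z N) = {ℓ₁, ℓ₂, ℓ₃}) :
    ℓ₃ = ℓ₁ + ℓ₂ := by
  obtain ⟨α, β, hα, hβ, hgap⟩ := exists_gapOf_kroneckerPts_eq_or hirr hN2
  have hval : ∀ ℓ ∈ gapValues (kroneckerPts z N), ℓ = α ∨ ℓ = β ∨ ℓ = α + β := by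
    intro ℓ hℓ
    obtain ⟨x, hx, rfl⟩ := Finset.mem_image.1 hℓ
    exact hgap x hx
  rw [hvals] at hval
  rcases hval ℓ₁ (by simp) with h1 | h1 | h1 <;>
  rcases hval ℓ₂ (by simp) with h2 | h2 | h2 <;>
  rcases hval ℓ₃ (by simp) with h3 | h3 | h3 <;> linarith
end

section
/- Two-gap case at denominator sums: for every m ≥ 1 and N = q_m + q_{m-1}, the gaps of P_N take exactly two distinct values; precisely, exactly q_m of the gaps have length K_{m-1} and exactly q_{m-1} of the gaps have length K_m. -/
open Finset Filter

/-- If no point of `S` lies strictly between `x` and `x + g`, and `x + g` is a point of `S` or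
the right end of the unit interval, then the gap of `S` at `x` is `g`. -/
lemma gapOf_eq_of_isNext {S : Finset ℝ} (hS : ∀ y ∈ S, y < 1) {x g : ℝ} (hg : 0 < g)
    (hempty : ∀ y ∈ S, x < y → x + g ≤ y) (hnext : x + g ∈ S ∨ x + g = 1) :
    gapOf S x = g := by
  classical
  unfold gapOf
  split_ifs with h
  · obtain ⟨hyS, hxy⟩ := Finset.mem_filter.1 (Finset.min'_mem _ h)
    have hle := hempty _ hyS hxy
    rcases hnext with hmem | hone
    · have hmin := Finset.min'_le (S.filter fun y => x < y) (x + g)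
        (Finset.mem_filter.2 ⟨hmem, by linarith⟩)
      linarith
    · linarith [hS _ hyS]
  · rcases hnext with hmem | hone
    · exact absurd ⟨x + g, Finset.mem_filter.2 ⟨hmem, by linarith⟩⟩ h
    · linarith

lemma fract_mul_mem_kroneckerPts (z : ℝ) {N n : ℕ} (hn : n < N) :
    Int.fract ((n : ℝ) * z) ∈ kroneckerPts z N :=
  Finset.mem_image.2 ⟨n, Finset.mem_range.2 hn, rfl⟩

/-- If `j` is reached from `n` by a rotation through `g` (mod 1), and no index below `N` lands
strictly inside the arc of length `g` starting at `{n z}`, then the gap at `{n z}` is `g`. -/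
lemma gapOf_kroneckerPts_eq_s4 {z g : ℝ} {N n j : ℕ} {k : ℤ} (hj : j < N) (hg : 0 < g)
    (hjn : (j : ℝ) * z = n * z + g + k)
    (hempty : ∀ i : ℕ, i < N → ∀ l : ℤ,
      0 < (i : ℝ) * z - n * z - l → g ≤ (i : ℝ) * z - n * z - l) :
    gapOf (kroneckerPts z N) (Int.fract ((n : ℝ) * z)) = g := by
  have hle : Int.fract ((n : ℝ) * z) + g ≤ 1 := by
    have hpos := Int.fract_lt_one ((n : ℝ) * z)
    have := hempty 0 (by omega) (-⌊(n : ℝ) * z⌋ - 1)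
    rw [Int.fract] at hpos ⊢
    push_cast at this
    linarith [this (by linarith)]
  refine gapOf_eq_of_isNext ?_ hg ?_ ?_
  · intro y hy
    obtain ⟨i, -, rfl⟩ := Finset.mem_image.1 hy
    exact Int.fract_lt_one _
  · intro y hy hlt
    obtain ⟨i, hi, rfl⟩ := Finset.mem_image.1 hy
    have := hempty i (Finset.mem_range.1 hi) (⌊(i : ℝ) * z⌋ - ⌊(n : ℝ) * z⌋)
    simp only [Int.fract] at hlt ⊢
    push_cast at this
    linarith [this (by linarith)]
  · rcases hle.lt_or_eq with hlt | heq
    · left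
      have : Int.fract ((j : ℝ) * z) = Int.fract ((n : ℝ) * z) + g := by
        refine Int.fract_eq_iff.2
          ⟨by linarith [Int.fract_nonneg ((n : ℝ) * z)], hlt, ⌊(n : ℝ) * z⌋ + k, ?_⟩
        rw [hjn, Int.fract]
        push_cast
        ring
      exact this ▸ fract_mul_mem_kroneckerPts z hj
    · exact Or.inr heq

/-- A lower and an upper approximation `s / r < z < s' / r'` that are Farey neighbours. -/
structure IsFareyBracket (z : ℝ) (r r' : ℕ) (s s' : ℤ) : Prop where
  left_pos : 0 < r
  right_pos : 0 < r'
  left_lt : 0 < (r : ℝ) * z - s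
  right_lt : 0 < (s' : ℝ) - r' * z
  det : (r : ℤ) * s' - r' * s = 1

namespace IsFareyBracket

variable {z : ℝ} {r r' : ℕ} {s s' : ℤ}

/-- Coordinates of `(d, k)` in the unimodular basis `(r, s)`, `(r', s')`. -/
lemma exists_coords (h : IsFareyBracket z r r' s s') (d k : ℤ) :
    ∃ x y : ℤ, d = x * r + y * r' ∧
      (d : ℝ) * z - k = x * ((r : ℝ) * z - s) - y * ((s' : ℝ) - r' * z) := by
  have hd : d = (d * s' - k * r') * r + (r * k - s * d) * r' := by
    linear_combination (-d) * h.det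
  have hk : k = (d * s' - k * r') * s + (r * k - s * d) * s' := by
    linear_combination (-k) * h.det
  refine ⟨d * s' - k * r', r * k - s * d, hd, ?_⟩
  have hd' := congrArg (Int.cast : ℤ → ℝ) hd
  have hk' := congrArg (Int.cast : ℤ → ℝ) hk
  push_cast at hd' hk' ⊢
  linear_combination z * hd' - hk'

lemma gapOf_of_lt (h : IsFareyBracket z r r' s s') {n : ℕ} (hn : n < r') :
    gapOf (kroneckerPts z (r + r')) (Int.fract ((n : ℝ) * z)) = (r : ℝ) * z - s := by
  refine gapOf_kroneckerPts_eq_s4 (j := n + r) (k := s) (by omega) h.left_lt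
    (by push_cast; ring) fun i hi l hpos => ?_
  by_contra! hlt
  obtain ⟨x, y, hd, hxy⟩ := h.exists_coords ((i : ℤ) - n) l
  have hα := h.left_lt
  have hβ := h.right_lt
  push_cast at hxy
  rw [← sub_mul, hxy] at hpos hlt
  rcases le_or_gt x 0 with hx | hx
  · have hxR : (x : ℝ) ≤ 0 := by exact_mod_cast hx
    have hy : y < 0 := by
      by_contra! hy
      have hyR : (0 : ℝ) ≤ y := by exact_mod_cast hy
      nlinarith [mul_nonneg hyR hβ.le, mul_nonneg (neg_nonneg.2 hxR) hα.le]
    nlinarith [mul_nonneg (neg_nonneg.2 hx) (Int.natCast_nonneg r),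
      mul_nonneg (by omega : 0 ≤ -1 - y) (Int.natCast_nonneg r')]
  · have hxR : (1 : ℝ) ≤ x := by exact_mod_cast hx
    have hy : 0 < y := by
      by_contra! hy
      have hyR : (y : ℝ) ≤ 0 := by exact_mod_cast hy
      nlinarith [mul_nonneg (neg_nonneg.2 hyR) hβ.le, mul_nonneg (sub_nonneg.2 hxR) hα.le]
    nlinarith [mul_nonneg (by omega : 0 ≤ x - 1) (Int.natCast_nonneg r),
      mul_nonneg (by omega : 0 ≤ y - 1) (Int.natCast_nonneg r')]

lemma gapOf_of_le (h : IsFareyBracket z r r' s s') {n : ℕ} (hn : r' ≤ n) (hnN : n < r + r') :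
    gapOf (kroneckerPts z (r + r')) (Int.fract ((n : ℝ) * z)) = (s' : ℝ) - r' * z := by
  refine gapOf_kroneckerPts_eq_s4 (j := n - r') (k := -s') (by omega) h.right_lt
    (by push_cast [Nat.cast_sub hn]; ring) fun i hi l hpos => ?_
  by_contra! hlt
  obtain ⟨x, y, hd, hxy⟩ := h.exists_coords ((i : ℤ) - n) l
  have hα := h.left_lt
  have hβ := h.right_lt
  push_cast at hxy
  rw [← sub_mul, hxy] at hpos hlt
  rcases lt_or_ge y 0 with hy | hy
  · have hyR : (y : ℝ) ≤ -1 := by exact_mod_cast (by omega : y ≤ -1)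
    have hx : x < 0 := by
      by_contra! hx
      have hxR : (0 : ℝ) ≤ x := by exact_mod_cast hx
      nlinarith [mul_nonneg hxR hα.le, mul_nonneg (sub_nonneg.2 hyR) hβ.le]
    nlinarith [mul_nonneg (by omega : 0 ≤ -1 - x) (Int.natCast_nonneg r),
      mul_nonneg (by omega : 0 ≤ -1 - y) (Int.natCast_nonneg r')]
  · have hyR : (0 : ℝ) ≤ y := by exact_mod_cast hy
    have hx : 0 < x := by
      by_contra! hx
      have hxR : (x : ℝ) ≤ 0 := by exact_mod_cast hx
      nlinarith [mul_nonneg hyR hβ.le, mul_nonneg (neg_nonneg.2 hxR) hα.le]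
    nlinarith [mul_nonneg (by omega : 0 ≤ x - 1) (Int.natCast_nonneg r),
      mul_nonneg hy (Int.natCast_nonneg r')]

lemma left_ne_right (h : IsFareyBracket z r r' s s') (hz : Irrational z) :
    (r : ℝ) * z - s ≠ (s' : ℝ) - r' * z := by
  intro heq
  have hr : r + r' ≠ 0 := by have := h.left_pos; omega
  refine (hz.natCast_mul hr).ne_int (s + s') ?_
  push_cast
  linarith

end IsFareyBracket

lemma Irrational.injective_fract_natCast_mul {z : ℝ} (hz : Irrational z) :
    Function.Injective fun n : ℕ => Int.fract ((n : ℝ) * z) := by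
  intro i j hij
  obtain ⟨k, hk⟩ := Int.fract_eq_fract.1 hij
  by_contra hne
  have hne' : (i : ℤ) - j ≠ 0 := by omega
  refine (hz.intCast_mul hne').ne_int k ?_
  push_cast
  linarith

lemma gapCount_kroneckerPts {z : ℝ} (hz : Irrational z) (N : ℕ) (L : ℝ) :
    gapCount (kroneckerPts z N) L = Nat.card
      {n : ℕ // n < N ∧ gapOf (kroneckerPts z N) (Int.fract ((n : ℝ) * z)) = L} := by
  classical
  rw [gapCount, Nat.subtype_card
    ((Finset.range N).filter fun n : ℕ =>
      gapOf (kroneckerPts z N) (Int.fract ((n : ℝ) * z)) = L) (by simp)]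
  conv_lhs => rw [kroneckerPts, Finset.filter_image]
  rw [Finset.card_image_of_injective _ hz.injective_fract_natCast_mul]
  congr!

namespace IsFareyBracket

variable {z : ℝ} {r r' : ℕ} {s s' : ℤ}

lemma gapCount_left (h : IsFareyBracket z r r' s s') (hz : Irrational z) :
    gapCount (kroneckerPts z (r + r')) ((r : ℝ) * z - s) = r' := by
  rw [gapCount_kroneckerPts hz, Nat.subtype_card (Finset.range r'), Finset.card_range]
  intro n
  rw [Finset.mem_range]
  refine ⟨fun hn => ⟨by omega, h.gapOf_of_lt hn⟩, fun ⟨hnN, hgap⟩ => ?_⟩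
  by_contra! hn
  exact h.left_ne_right hz (hgap.symm.trans (h.gapOf_of_le hn hnN))

lemma gapCount_right (h : IsFareyBracket z r r' s s') (hz : Irrational z) :
    gapCount (kroneckerPts z (r + r')) ((s' : ℝ) - r' * z) = r := by
  rw [gapCount_kroneckerPts hz, Nat.subtype_card (Finset.Ico r' (r + r')), Nat.card_Ico,
    Nat.add_sub_cancel]
  intro n
  rw [Finset.mem_Ico]
  refine ⟨fun ⟨hn, hnN⟩ => ⟨hnN, h.gapOf_of_le hn hnN⟩, fun ⟨hnN, hgap⟩ => ⟨?_, hnN⟩⟩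
  by_contra! hn
  exact h.left_ne_right hz ((h.gapOf_of_lt hn).symm.trans hgap)

lemma gapValues_eq (h : IsFareyBracket z r r' s s') :
    gapValues (kroneckerPts z (r + r')) = {(r : ℝ) * z - s, (s' : ℝ) - r' * z} := by
  classical
  have hr := h.left_pos
  have hr' := h.right_pos
  ext g
  simp only [gapValues, Finset.mem_image, Finset.mem_insert, Finset.mem_singleton]
  constructor
  · rintro ⟨x, hx, rfl⟩
    obtain ⟨n, hn, rfl⟩ := Finset.mem_image.1 hx
    rcases lt_or_ge n r' with hlt | hle
    · exact Or.inl (h.gapOf_of_lt hlt)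
    · exact Or.inr (h.gapOf_of_le hle (Finset.mem_range.1 hn))
  · rintro (rfl | rfl)
    · exact ⟨_, fract_mul_mem_kroneckerPts z (n := 0) (by omega), h.gapOf_of_lt hr'⟩
    · exact ⟨_, fract_mul_mem_kroneckerPts z (n := r') (by omega),
        h.gapOf_of_le le_rfl (by omega)⟩

lemma card_gapValues (h : IsFareyBracket z r r' s s') (hz : Irrational z) :
    (gapValues (kroneckerPts z (r + r'))).card = 2 := by
  rw [h.gapValues_eq, Finset.card_pair (h.left_ne_right hz)]

end IsFareyBracket

/-- Numerators and denominators, indexed from `0`, of the convergents of a continued fraction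
with partial quotients `0, a 1, a 2, …`. -/
structure IsConvergentSeq (a P Q : ℕ → ℤ) : Prop where
  quot_pos : ∀ n, 1 ≤ n → 1 ≤ a n
  num_zero : P 0 = 0
  num_one : P 1 = 1
  den_zero : Q 0 = 1
  den_one : Q 1 = a 1
  num_step : ∀ n, P (n + 2) = a (n + 2) * P (n + 1) + P n
  den_step : ∀ n, Q (n + 2) = a (n + 2) * Q (n + 1) + Q n

namespace IsConvergentSeq

variable {a P Q : ℕ → ℤ}

lemma den_pos (h : IsConvergentSeq a P Q) (n : ℕ) : 0 < Q n := by
  induction n using Nat.twoStepInduction with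
  | zero => rw [h.den_zero]; exact one_pos
  | one => rw [h.den_one]; exact h.quot_pos 1 le_rfl
  | more n ih₀ ih₁ =>
    rw [h.den_step]
    nlinarith [h.quot_pos (n + 2) (by omega)]

lemma det (h : IsConvergentSeq a P Q) (n : ℕ) :
    P (n + 1) * Q n - P n * Q (n + 1) = (-1) ^ n := by
  induction n with
  | zero => simp [h.num_zero, h.num_one, h.den_zero]
  | succ n ih =>
    rw [h.num_step, h.den_step, pow_succ]
    linear_combination -ih

lemma det_two (h : IsConvergentSeq a P Q) (n : ℕ) :
    P (n + 2) * Q n - P n * Q (n + 2) = (-1) ^ n * a (n + 2) := by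
  rw [h.num_step, h.den_step]
  linear_combination a (n + 2) * h.det n

lemma even_lt {z : ℝ} (h : IsConvergentSeq a P Q)
    (hz : Tendsto (fun n => (P n : ℝ) / Q n) atTop (nhds z)) {n : ℕ} (hn : Even n) :
    0 < (Q n : ℝ) * z - P n := by
  have hQ : ∀ n, (0 : ℝ) < Q n := fun n => by exact_mod_cast h.den_pos n
  have hmono : StrictMono fun k : ℕ => (P (2 * k) : ℝ) / Q (2 * k) := by
    refine strictMono_nat_of_lt_succ fun k => ?_
    rw [div_lt_div_iff₀ (hQ _) (hQ _)]
    have hdet := h.det_two (2 * k)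
    rw [pow_mul, neg_one_sq, one_pow] at hdet
    have := h.quot_pos (2 * k + 2) (by omega)
    rw [show 2 * (k + 1) = 2 * k + 2 by ring]
    exact_mod_cast (by linarith : P (2 * k) * Q (2 * k + 2) < P (2 * k + 2) * Q (2 * k))
  have hlim := hz.comp
    (tendsto_atTop_mono (fun k : ℕ => (by omega : k ≤ 2 * k)) tendsto_id)
  obtain ⟨k, rfl⟩ := even_iff_exists_two_mul.1 hn
  have hlt := (hmono k.lt_succ_self).trans_le (hmono.monotone.ge_of_tendsto hlim _)
  rw [div_lt_iff₀ (hQ _)] at hlt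
  linarith

lemma lt_odd {z : ℝ} (h : IsConvergentSeq a P Q)
    (hz : Tendsto (fun n => (P n : ℝ) / Q n) atTop (nhds z)) {n : ℕ} (hn : Odd n) :
    0 < (P n : ℝ) - Q n * z := by
  have hQ : ∀ n, (0 : ℝ) < Q n := fun n => by exact_mod_cast h.den_pos n
  have hanti : StrictAnti fun k : ℕ => (P (2 * k + 1) : ℝ) / Q (2 * k + 1) := by
    refine strictAnti_nat_of_succ_lt fun k => ?_
    rw [div_lt_div_iff₀ (hQ _) (hQ _)]
    have hdet := h.det_two (2 * k + 1)
    rw [pow_succ, pow_mul, neg_one_sq, one_pow] at hdet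
    have := h.quot_pos (2 * k + 1 + 2) (by omega)
    rw [show 2 * (k + 1) + 1 = 2 * k + 1 + 2 by ring]
    exact_mod_cast
      (by linarith : P (2 * k + 1 + 2) * Q (2 * k + 1) < P (2 * k + 1) * Q (2 * k + 1 + 2))
  have hlim := hz.comp
    (tendsto_atTop_mono (fun k : ℕ => (by omega : k ≤ 2 * k + 1)) tendsto_id)
  obtain ⟨k, rfl⟩ := hn
  have hlt := (hanti.antitone.le_of_tendsto hlim _).trans_lt (hanti k.lt_succ_self)
  rw [lt_div_iff₀ (hQ _)] at hlt
  linarith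

lemma isFareyBracket_of_even {z : ℝ} (h : IsConvergentSeq a P Q)
    (hz : Tendsto (fun n => (P n : ℝ) / Q n) atTop (nhds z)) {n : ℕ} (hn : Even n)
    {r r' : ℕ} (hr : (r : ℤ) = Q n) (hr' : (r' : ℤ) = Q (n + 1)) :
    IsFareyBracket z r r' (P n) (P (n + 1)) where
  left_pos := by have := h.den_pos n; omega
  right_pos := by have := h.den_pos (n + 1); omega
  left_lt := by
    rw [← Int.cast_natCast r, hr]
    exact h.even_lt hz hn
  right_lt := by
    rw [← Int.cast_natCast r', hr']
    exact h.lt_odd hz hn.add_one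
  det := by
    have := h.det n
    rw [hn.neg_one_pow] at this
    rw [hr, hr']
    linarith

lemma isFareyBracket_of_odd {z : ℝ} (h : IsConvergentSeq a P Q)
    (hz : Tendsto (fun n => (P n : ℝ) / Q n) atTop (nhds z)) {n : ℕ} (hn : Odd n)
    {r r' : ℕ} (hr : (r : ℤ) = Q (n + 1)) (hr' : (r' : ℤ) = Q n) :
    IsFareyBracket z r r' (P (n + 1)) (P n) where
  left_pos := by have := h.den_pos (n + 1); omega
  right_pos := by have := h.den_pos n; omega
  left_lt := by
    rw [← Int.cast_natCast r, hr]
    exact h.even_lt hz hn.add_one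
  right_lt := by
    rw [← Int.cast_natCast r', hr']
    exact h.lt_odd hz hn
  det := by
    have := h.det n
    rw [hn.neg_one_pow] at this
    rw [hr, hr']
    linarith

end IsConvergentSeq

/-- **Two-gap case at denominator sums.** For every `m ≥ 1` and `N = q_m + q_{m-1}`,
the gaps of `P_N` take exactly two distinct values: exactly `q_m` gaps of length
`K_{m-1}` and exactly `q_{m-1}` gaps of length `K_m`. -/
theorem two_gap_at_denominator_sums
    (z : ℝ) (hirr : Irrational z) (hz0 : 0 < z) (hz1 : z < 1)
    (a p q : ℤ → ℤ)
    (ha0 : a 0 = 0) (ha : ∀ n : ℤ, 1 ≤ n → 1 ≤ a n)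
    (hp2 : p (-2) = 0) (hp1 : p (-1) = 1)
    (hq2 : q (-2) = 1) (hq1 : q (-1) = 0)
    (hp : ∀ n : ℤ, 0 ≤ n → p n = a n * p (n - 1) + p (n - 2))
    (hq : ∀ n : ℤ, 0 ≤ n → q n = a n * q (n - 1) + q (n - 2))
    (hconv : Tendsto (fun n : ℕ => (p n : ℝ) / (q n : ℝ)) atTop (nhds z))
    (K : ℤ → ℝ) (hK : ∀ n : ℤ, -1 ≤ n → K n = |(q n : ℝ) * z - (p n : ℝ)|)
    (m : ℕ) (hm : 1 ≤ m) (N : ℕ) (hN : (N : ℤ) = q m + q ((m : ℤ) - 1)) :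
    (gapValues (kroneckerPts z N)).card = 2 ∧
    (gapCount (kroneckerPts z N) (K ((m : ℤ) - 1)) : ℤ) = q m ∧
    (gapCount (kroneckerPts z N) (K m) : ℤ) = q ((m : ℤ) - 1) := by
  obtain ⟨n, rfl⟩ : ∃ n, m = n + 1 := ⟨m - 1, by omega⟩
  have hseq : IsConvergentSeq (fun n => a n) (fun n => p n) (fun n => q n) := by
    have hp0 : p 0 = 0 := by rw [hp 0 le_rfl, ha0]; simpa using hp2
    have hq0 : q 0 = 1 := by rw [hq 0 le_rfl, ha0]; simpa using hq2
    refine ⟨fun n hn => ha n (by exact_mod_cast hn), hp0, ?_, hq0, ?_, fun n => ?_, fun n => ?_⟩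
    · have := hp 1 (by norm_num)
      norm_num [hp0, hp1] at this
      simpa using this
    · have := hq 1 (by norm_num)
      norm_num [hq0, hq1] at this
      simpa using this
    · have := hp (n + 2) (by omega)
      rw [show (n : ℤ) + 2 - 1 = n + 1 by ring, show (n : ℤ) + 2 - 2 = n by ring] at this
      exact_mod_cast this
    · have := hq (n + 2) (by omega)
      rw [show (n : ℤ) + 2 - 1 = n + 1 by ring, show (n : ℤ) + 2 - 2 = n by ring] at this
      exact_mod_cast this
  have hpred : ((n + 1 : ℕ) : ℤ) - 1 = n := by push_cast; ring
  rw [hpred] at hN ⊢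
  obtain ⟨u, hu⟩ := Int.eq_ofNat_of_zero_le (hseq.den_pos n).le
  obtain ⟨v, hv⟩ := Int.eq_ofNat_of_zero_le (hseq.den_pos (n + 1)).le
  rw [hK n (by omega), hK (n + 1 : ℕ) (by omega), hu, hv]
  rw [hu, hv] at hN
  simp only [Int.cast_natCast, Nat.cast_inj]
  rcases n.even_or_odd with hn | hn
  · have hF := hseq.isFareyBracket_of_even hconv hn hu.symm hv.symm
    obtain rfl : N = u + v := by omega
    rw [abs_of_pos hF.left_lt, abs_sub_comm, abs_of_pos hF.right_lt]
    exact ⟨hF.card_gapValues hirr, hF.gapCount_left hirr, hF.gapCount_right hirr⟩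
  · have hF := hseq.isFareyBracket_of_odd hconv hn hv.symm hu.symm
    obtain rfl : N = v + u := by omega
    rw [abs_of_pos hF.left_lt, abs_sub_comm, abs_of_pos hF.right_lt]
    exact ⟨hF.card_gapValues hirr, hF.gapCount_right hirr, hF.gapCount_left hirr⟩
end

section
/- Dichotomy between two and three gap lengths: the gaps of P_N take exactly two distinct values if N = b_m·q_m + q_{m-1} (equivalently N₁ := N - b_m·q_m - q_{m-1} = 0), and exactly three distinct values if N > b_m·q_m + q_{m-1}. -/
open Finset Filter

/-- If `x + δ` is a point of `S` (or equals `1`) and no point of `S` lies strictly between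
`x` and `x + δ`, then the gap at `x` is `δ`. -/
lemma gapOf_eq_of_next {S : Finset ℝ} {x δ : ℝ} (hδ : 0 < δ) (hS : ∀ y ∈ S, y < 1)
    (hnext : x + δ ∈ S ∨ x + δ = 1) (hempty : ∀ y ∈ S, x < y → x + δ ≤ y) :
    gapOf S x = δ := by
  classical
  unfold gapOf
  split_ifs with h
  · have hmin := Finset.min'_mem _ h
    have hle := fun y hy => Finset.min'_le (S.filter fun y => x < y) y hy
    rw [Finset.mem_filter] at hmin
    have h1 := hempty _ hmin.1 hmin.2
    rcases hnext with h2 | h2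
    · have := hle (x + δ) (by simp [h2, hδ])
      linarith
    · linarith [hS _ hmin.1]
  · rcases hnext with h2 | h2
    · exact absurd ⟨x + δ, by simp [h2, hδ]⟩ h
    · linarith

lemma kroneckerPts_lt_one {z : ℝ} {N : ℕ} {y : ℝ} (hy : y ∈ kroneckerPts z N) : y < 1 := by
  simp only [kroneckerPts, Finset.mem_image] at hy
  obtain ⟨n, -, rfl⟩ := hy
  exact Int.fract_lt_one _

/-- The gap at `{n z}` is `δ` if moving by `k` steps advances by `δ` modulo `1` and no
admissible move advances by a smaller positive amount. -/
lemma gapOf_kroneckerPts {z δ : ℝ} {N n : ℕ} {k l : ℤ} (hδ : 0 < δ) (hk : k * z - l = δ)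
    (hk0 : 0 ≤ n + k) (hkN : n + k < N)
    (hempty : ∀ u v : ℤ, -(n : ℤ) ≤ u → u < N - n → 0 < u * z - v → δ ≤ u * z - v) :
    gapOf (kroneckerPts z N) (Int.fract ((n : ℝ) * z)) = δ := by
  have hfr : Int.fract ((n : ℝ) * z) = n * z - ⌊(n : ℝ) * z⌋ := rfl
  have hle : Int.fract ((n : ℝ) * z) + δ ≤ 1 := by
    have := hempty (-n) (-⌊(n : ℝ) * z⌋ - 1) (by lia) (by lia)
    have h1 := Int.fract_lt_one ((n : ℝ) * z)
    push_cast at this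
    have := this (by linarith)
    linarith
  refine gapOf_eq_of_next hδ (fun y hy => kroneckerPts_lt_one hy) ?_ ?_
  · rcases hle.eq_or_lt with h | h
    · exact Or.inr h
    · left
      obtain ⟨n', hn'⟩ := Int.eq_ofNat_of_zero_le hk0
      simp only [kroneckerPts, Finset.mem_image, Finset.mem_range]
      refine ⟨n', by lia, ?_⟩
      rw [Int.fract_eq_iff]
      refine ⟨add_nonneg (Int.fract_nonneg _) hδ.le, h, l + ⌊(n : ℝ) * z⌋, ?_⟩
      have hcast : (n : ℝ) + k = n' := by exact_mod_cast hn'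
      rw [← hcast, hfr, ← hk]
      push_cast
      ring
  · intro y hy hxy
    simp only [kroneckerPts, Finset.mem_image, Finset.mem_range] at hy
    obtain ⟨n', hn', rfl⟩ := hy
    have hfr' : Int.fract ((n' : ℝ) * z) = n' * z - ⌊(n' : ℝ) * z⌋ := rfl
    have := hempty (n' - n) (⌊(n' : ℝ) * z⌋ - ⌊(n : ℝ) * z⌋) (by lia) (by lia)
    push_cast at this
    have := this (by linarith)
    linarith

/-- The three gap theorem for a unimodular pair of approximations `P / Q < z < P' / Q'`
and `max Q Q' ≤ N < Q + Q'`. -/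
lemma mem_gapValues_kroneckerPts {z α β : ℝ} {N : ℕ} {Q P Q' P' : ℤ}
    (hα : 0 < α) (hβ : 0 < β) (hαQ : Q * z - P = α) (hβQ : P' - Q' * z = β)
    (hdet : (Q * P' - P * Q') ^ 2 = 1) (hQ : 0 ≤ Q) (hQ' : 0 ≤ Q')
    (hQN : Q ≤ N) (hQN' : Q' ≤ N) (hN : N < Q + Q') (L : ℝ) :
    L ∈ gapValues (kroneckerPts z N) ↔
      (L = α ∧ Q < N) ∨ (L = β ∧ Q' < N) ∨ L = α + β := by
  have hdet1 : Q * P' - P * Q' = 1 := by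
    have hpos : (0 : ℝ) < Q * P' - P * Q' := by
      have hsum : (Q : ℝ) * P' - P * Q' = Q * β + Q' * α := by rw [← hαQ, ← hβQ]; ring
      have hQ0 : (0 : ℝ) ≤ Q := by exact_mod_cast hQ
      have hQ0' : (0 : ℝ) ≤ Q' := by exact_mod_cast hQ'
      rw [hsum]
      rcases hQ.eq_or_lt with h | h
      · have : (0 : ℝ) < Q' := by exact_mod_cast (by lia : 0 < Q')
        positivity
      · have : (0 : ℝ) < Q := by exact_mod_cast h
        positivity
    have hpos' : 0 < Q * P' - P * Q' := by exact_mod_cast hpos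
    nlinarith
  have hcoord (u v : ℤ) : ∃ i j : ℤ, u = i * Q - j * Q' ∧ (u * z - v : ℝ) = i * α + j * β := by
    refine ⟨u * P' - v * Q', u * P - v * Q, ?_, ?_⟩
    · linear_combination -u * hdet1
    · have hdetR : (Q * P' - P * Q' : ℝ) = 1 := by exact_mod_cast hdet1
      push_cast
      rw [← hαQ, ← hβQ]
      linear_combination (v - u * z) * hdetR
  have hge {i : ℤ} (h : 1 ≤ i) {t : ℝ} (ht : 0 < t) : t ≤ i * t := by
    have : (1 : ℝ) ≤ i := by exact_mod_cast h
    nlinarith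
  have hle {i : ℤ} (h : i ≤ 0) {t : ℝ} (ht : 0 < t) : i * t ≤ 0 := by
    have : (i : ℝ) ≤ 0 := by exact_mod_cast h
    nlinarith
  have gapα (n : ℕ) (hn : n + Q < N) :
      gapOf (kroneckerPts z N) (Int.fract ((n : ℝ) * z)) = α := by
    refine gapOf_kroneckerPts (k := Q) (l := P) hα hαQ (by lia) (by lia) ?_
    intro u v hu hu' h0
    obtain ⟨i, j, hij, hval⟩ := hcoord u v
    rw [hval] at h0 ⊢
    by_contra! hlt
    rcases le_or_gt 1 i with hi | hi
    · rcases le_or_gt 0 j with hj | hj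
      · have : (0 : ℝ) ≤ j := by exact_mod_cast hj
        nlinarith [hge hi hα]
      · nlinarith
    · rcases le_or_gt 1 j with hj | hj
      · nlinarith
      · linarith [hle (by lia : i ≤ 0) hα, hle (by lia : j ≤ 0) hβ]
  have gapβ (n : ℕ) (hn : Q' ≤ n) (hnN : n < N) :
      gapOf (kroneckerPts z N) (Int.fract ((n : ℝ) * z)) = β := by
    refine gapOf_kroneckerPts (k := -Q') (l := -P') hβ (by push_cast; linarith)
      (by lia) (by lia) ?_
    intro u v hu hu' h0
    obtain ⟨i, j, hij, hval⟩ := hcoord u v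
    rw [hval] at h0 ⊢
    by_contra! hlt
    rcases le_or_gt 1 j with hj | hj
    · rcases le_or_gt 0 i with hi | hi
      · have : (0 : ℝ) ≤ i := by exact_mod_cast hi
        nlinarith [hge hj hβ]
      · nlinarith
    · rcases le_or_gt 1 i with hi | hi
      · nlinarith
      · linarith [hle (by lia : i ≤ 0) hα, hle (by lia : j ≤ 0) hβ]
  have gapαβ (n : ℕ) (hn : N ≤ n + Q) (hnQ : n < Q') :
      gapOf (kroneckerPts z N) (Int.fract ((n : ℝ) * z)) = α + β := by
    refine gapOf_kroneckerPts (k := Q - Q') (l := P - P') (by positivity)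
      (by push_cast; linarith) (by lia) (by lia) ?_
    intro u v hu hu' h0
    obtain ⟨i, j, hij, hval⟩ := hcoord u v
    rw [hval] at h0 ⊢
    by_contra! hlt
    rcases le_or_gt 1 i with hi | hi
    · rcases le_or_gt 1 j with hj | hj
      · linarith [hge hi hα, hge hj hβ]
      · nlinarith
    · rcases le_or_gt 1 j with hj | hj
      · nlinarith
      · linarith [hle (by lia : i ≤ 0) hα, hle (by lia : j ≤ 0) hβ]
  have hmem : L ∈ gapValues (kroneckerPts z N) ↔
      ∃ n < N, gapOf (kroneckerPts z N) (Int.fract ((n : ℝ) * z)) = L := by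
    simp [gapValues, kroneckerPts]
  rw [hmem]
  constructor
  · rintro ⟨n, hn, rfl⟩
    rcases lt_or_ge ((n : ℤ) + Q) N with h | h
    · exact Or.inl ⟨gapα n h, by lia⟩
    · rcases lt_or_ge (n : ℤ) Q' with h' | h'
      · exact Or.inr (Or.inr (gapαβ n h h'))
      · exact Or.inr (Or.inl ⟨gapβ n h' hn, by lia⟩)
  · rintro (⟨rfl, h⟩ | ⟨rfl, h⟩ | rfl)
    · exact ⟨0, by lia, gapα 0 (by simpa using h)⟩
    · exact ⟨Q'.toNat, by lia, gapβ _ (by lia) (by lia)⟩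
    · exact ⟨(N - Q).toNat, by lia, gapαβ _ (by lia) (by lia)⟩

/-- The number of gap lengths for a unimodular pair of approximations `P / Q < z < P' / Q'`
and `max Q Q' ≤ N < Q + Q'`. -/
lemma card_gapValues_kroneckerPts {z : ℝ} (hirr : Irrational z) {N : ℕ} {Q P Q' P' : ℤ}
    (hα : 0 < Q * z - P) (hβ : 0 < P' - Q' * z)
    (hdet : (Q * P' - P * Q') ^ 2 = 1) (hQ : 0 ≤ Q) (hQ' : 0 ≤ Q')
    (hQN : Q ≤ N) (hQN' : Q' ≤ N) (hN : N < Q + Q') :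
    (Q < N → Q' < N → (gapValues (kroneckerPts z N)).card = 3) ∧
    (Q < N → Q' = N → (gapValues (kroneckerPts z N)).card = 2) ∧
    (Q = N → Q' < N → (gapValues (kroneckerPts z N)).card = 2) := by
  classical
  have hmem := mem_gapValues_kroneckerPts hα hβ rfl rfl hdet hQ hQ' hQN hQN' hN
  generalize hα' : Q * z - P = α at *
  generalize hβ' : P' - Q' * z = β at *
  have hne : α ≠ β := by
    intro h
    have hirr' := hirr.intCast_mul (show Q + Q' ≠ 0 by lia)
    refine (hirr'.ne_int (P + P')) ?_
    push_cast
    linarith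
  have hne1 : α ≠ α + β := by linarith
  have hne2 : β ≠ α + β := by linarith
  refine ⟨fun h h' => ?_, fun h h' => ?_, fun h h' => ?_⟩
  · rw [show gapValues (kroneckerPts z N) = {α, β, α + β} by ext L; simp [hmem, h, h']]
    exact Finset.card_eq_three.2 ⟨_, _, _, hne, hne1, hne2, rfl⟩
  · rw [show gapValues (kroneckerPts z N) = {α, α + β} by ext L; simp [hmem, h, h']]
    exact Finset.card_pair hne1
  · rw [show gapValues (kroneckerPts z N) = {β, α + β} by ext L; simp [hmem, h, h']]
    exact Finset.card_pair hne2

/-- Denominators generated by positive partial quotients are nonnegative, and positive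
from index `0` on. -/
lemma denominators_pos {a q : ℤ → ℤ} (ha0 : a 0 = 0) (ha : ∀ n : ℤ, 1 ≤ n → 1 ≤ a n)
    (hq2 : q (-2) = 1) (hq1 : q (-1) = 0)
    (hq : ∀ n : ℤ, 0 ≤ n → q n = a n * q (n - 1) + q (n - 2)) (n : ℕ) :
    0 < q n ∧ 0 ≤ q ((n : ℤ) - 1) := by
  induction n with
  | zero =>
    have h := hq 0 le_rfl
    norm_num [ha0, hq2, hq1] at h
    simp [h, hq1]
  | succ n ih =>
    have h := hq (n + 1) (by positivity)
    have ha' := ha (n + 1) (by lia)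
    rw [show (n : ℤ) + 1 - 1 = n by ring, show (n : ℤ) + 1 - 2 = n - 1 by ring] at h
    push_cast
    rw [show (n : ℤ) + 1 - 1 = n by ring, h]
    exact ⟨by nlinarith, ih.1.le⟩

/-- Consecutive convergents are unimodular. -/
lemma convergents_det_sq {a p q : ℤ → ℤ}
    (hp2 : p (-2) = 0) (hp1 : p (-1) = 1) (hq2 : q (-2) = 1) (hq1 : q (-1) = 0)
    (hp : ∀ n : ℤ, 0 ≤ n → p n = a n * p (n - 1) + p (n - 2))
    (hq : ∀ n : ℤ, 0 ≤ n → q n = a n * q (n - 1) + q (n - 2)) (n : ℕ) :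
    (q n * p ((n : ℤ) - 1) - p n * q ((n : ℤ) - 1)) ^ 2 = 1 := by
  induction n with
  | zero =>
    have h := hq 0 le_rfl
    have h' := hp 0 le_rfl
    norm_num [hp2, hp1, hq2, hq1] at h h'
    simp [h, h', hp1, hq1]
  | succ n ih =>
    have h := hq (n + 1) (by positivity)
    have h' := hp (n + 1) (by positivity)
    rw [show (n : ℤ) + 1 - 1 = n by ring, show (n : ℤ) + 1 - 2 = n - 1 by ring] at h h'
    push_cast
    rw [show (n : ℤ) + 1 - 1 = n by ring, h, h']
    linear_combination ih

/-- The errors `q n * z - p n` of consecutive convergents cannot have the same sign. -/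
lemma not_errors_pos_of_tendsto {a p q : ℤ → ℤ} {z ε : ℝ}
    (ha : ∀ n : ℤ, 1 ≤ n → 1 ≤ a n) (hqpos : ∀ n : ℕ, 0 < q n)
    (hp : ∀ n : ℤ, 0 ≤ n → p n = a n * p (n - 1) + p (n - 2))
    (hq : ∀ n : ℤ, 0 ≤ n → q n = a n * q (n - 1) + q (n - 2))
    (hconv : Tendsto (fun n : ℕ => (p n : ℝ) / (q n : ℝ)) atTop (nhds z)) (k : ℕ)
    (h0 : 0 < ε * (q k * z - p k))
    (h1 : 0 < ε * (q ((k : ℤ) + 1) * z - p ((k : ℤ) + 1))) : False := by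
  have hqR (n : ℕ) : (0 : ℝ) < q n := by exact_mod_cast hqpos n
  have hq1 : (0 : ℝ) < q ((k : ℤ) + 1) := by exact_mod_cast hqR (k + 1)
  obtain ⟨c, hc, hc0, hc1⟩ : ∃ c : ℝ, 0 < c ∧ c * q k ≤ ε * (q k * z - p k) ∧
      c * q ((k : ℤ) + 1) ≤ ε * (q ((k : ℤ) + 1) * z - p ((k : ℤ) + 1)) := by
    refine ⟨min (ε * (q k * z - p k) / q k)
      (ε * (q ((k : ℤ) + 1) * z - p ((k : ℤ) + 1)) / q ((k : ℤ) + 1)), ?_, ?_, ?_⟩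
    · exact lt_min (div_pos h0 (hqR k)) (div_pos h1 hq1)
    · rw [← le_div_iff₀ (hqR k)]; exact min_le_left _ _
    · rw [← le_div_iff₀ hq1]; exact min_le_right _ _
  have hall (j : ℕ) : c * q ((k : ℤ) + j) ≤ ε * (q ((k : ℤ) + j) * z - p ((k : ℤ) + j)) ∧
      c * q ((k : ℤ) + j + 1) ≤ ε * (q ((k : ℤ) + j + 1) * z - p ((k : ℤ) + j + 1)) := by
    induction j with
    | zero => simpa using ⟨hc0, hc1⟩
    | succ j ih =>
      obtain ⟨ih0, ih1⟩ := ih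
      have hA : (1 : ℝ) ≤ a ((k : ℤ) + j + 1 + 1) := by exact_mod_cast ha _ (by lia)
      have e1 := hq ((k : ℤ) + j + 1 + 1) (by positivity)
      have e2 := hp ((k : ℤ) + j + 1 + 1) (by positivity)
      rw [show (k : ℤ) + j + 1 + 1 - 1 = k + j + 1 by ring,
        show (k : ℤ) + j + 1 + 1 - 2 = k + j by ring] at e1 e2
      push_cast
      rw [← add_assoc]
      refine ⟨ih1, ?_⟩
      rw [e1, e2]
      push_cast
      have := mul_le_mul_of_nonneg_left ih1 (zero_le_one.trans hA)
      linarith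
  have hlim : Tendsto (fun n : ℕ => ε * (z - (p n : ℝ) / (q n : ℝ))) atTop
      (nhds (ε * (z - z))) := (tendsto_const_nhds.sub hconv).const_mul ε
  have hge : c ≤ ε * (z - z) := by
    refine ge_of_tendsto hlim (eventually_atTop.2 ⟨k, fun n hn => ?_⟩)
    obtain ⟨j, rfl⟩ := Nat.exists_eq_add_of_le hn
    have h := (hall j).1
    have hpos := hqR (k + j)
    push_cast at hpos ⊢
    have heq : ε * (z - (p ((k : ℤ) + j) : ℝ) / q ((k : ℤ) + j)) =
        ε * (q ((k : ℤ) + j) * z - p ((k : ℤ) + j)) / q ((k : ℤ) + j) := by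
      field_simp
    rw [heq, le_div_iff₀ hpos]
    exact h
  simp at hge
  linarith

/-- The errors of consecutive convergents alternate in sign. -/
lemma errors_mul_neg {a p q : ℤ → ℤ} {z : ℝ} (hirr : Irrational z)
    (ha : ∀ n : ℤ, 1 ≤ n → 1 ≤ a n) (hqpos : ∀ n : ℕ, 0 < q n)
    (hp : ∀ n : ℤ, 0 ≤ n → p n = a n * p (n - 1) + p (n - 2))
    (hq : ∀ n : ℤ, 0 ≤ n → q n = a n * q (n - 1) + q (n - 2))
    (hconv : Tendsto (fun n : ℕ => (p n : ℝ) / (q n : ℝ)) atTop (nhds z)) (k : ℕ) :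
    (q k * z - p k) * (q ((k : ℤ) + 1) * z - p ((k : ℤ) + 1)) < 0 := by
  have hne (n : ℕ) : (q n * z - p n : ℝ) ≠ 0 :=
    sub_ne_zero.2 ((hirr.intCast_mul (hqpos n).ne').ne_int _)
  have hne1 : (q ((k : ℤ) + 1) * z - p ((k : ℤ) + 1) : ℝ) ≠ 0 := by exact_mod_cast hne (k + 1)
  have hcontra (ε : ℝ) := not_errors_pos_of_tendsto (ε := ε) ha hqpos hp hq hconv k
  rcases (hne k).lt_or_gt with h | h <;> rcases hne1.lt_or_gt with h' | h'
  · exact (hcontra (-1) (by linarith) (by linarith)).elim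
  · exact mul_neg_of_neg_of_pos h h'
  · exact mul_neg_of_pos_of_neg h h'
  · exact (hcontra 1 (by linarith) (by linarith)).elim

/-- Sums of digits `b j ≤ a (j + 1)` weighted by denominators are less than
`q m + q (m - 1)`. -/
lemma sum_digits_lt {a q : ℤ → ℤ} {b : ℕ → ℤ} (hq0 : q 0 = 1) (hq1 : q (-1) = 0)
    (hqpos : ∀ n : ℕ, 0 < q n)
    (hq : ∀ n : ℤ, 0 ≤ n → q n = a n * q (n - 1) + q (n - 2)) (m : ℕ)
    (hb : ∀ j < m, b j ≤ a (j + 1)) :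
    ∑ j ∈ Finset.range m, b j * q j < q m + q ((m : ℤ) - 1) := by
  induction m with
  | zero => simp [hq0, hq1]
  | succ m ih =>
    have ih := ih fun j hj => hb j (by lia)
    have h := hq (m + 1) (by positivity)
    rw [show (m : ℤ) + 1 - 1 = m by ring, show (m : ℤ) + 1 - 2 = m - 1 by ring] at h
    rw [Finset.sum_range_succ]
    push_cast
    rw [show (m : ℤ) + 1 - 1 = m by ring, h]
    linarith [mul_le_mul_of_nonneg_right (hb m (by lia)) (hqpos m).le]

/-- **Dichotomy between two and three gap lengths.** The gaps of `P_N` take exactly two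
distinct values if `N = b_m q_m + q_{m-1}`, and exactly three distinct values if
`N > b_m q_m + q_{m-1}`. -/
theorem two_or_three_gaps_dichotomy
    (z : ℝ) (hirr : Irrational z) (hz0 : 0 < z) (hz1 : z < 1)
    (a p q : ℤ → ℤ)
    (ha0 : a 0 = 0) (ha : ∀ n : ℤ, 1 ≤ n → 1 ≤ a n)
    (hp2 : p (-2) = 0) (hp1 : p (-1) = 1)
    (hq2 : q (-2) = 1) (hq1 : q (-1) = 0)
    (hp : ∀ n : ℤ, 0 ≤ n → p n = a n * p (n - 1) + p (n - 2))
    (hq : ∀ n : ℤ, 0 ≤ n → q n = a n * q (n - 1) + q (n - 2))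
    (hconv : Tendsto (fun n : ℕ => (p n : ℝ) / (q n : ℝ)) atTop (nhds z))
    (K : ℤ → ℝ) (hK : ∀ n : ℤ, -1 ≤ n → K n = |(q n : ℝ) * z - (p n : ℝ)|)
    (N : ℕ) (hN2 : 2 ≤ N) (m : ℕ) (b : ℕ → ℤ)
    (hNlow : q m + 1 ≤ (N : ℤ)) (hNhigh : (N : ℤ) < q (m + 1) + q m)
    (hb : ∀ j ≤ m, 0 ≤ b j ∧ b j ≤ a (j + 1)) (hbm : 1 ≤ b m)
    (host : (N : ℤ) = ∑ j ∈ Finset.range (m + 1), b j * q j)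
 :
    ((N : ℤ) = b m * q m + q ((m : ℤ) - 1) →
      (gapValues (kroneckerPts z N)).card = 2) ∧
    (b m * q m + q ((m : ℤ) - 1) < (N : ℤ) →
      (gapValues (kroneckerPts z N)).card = 3) := by
  have hqnn := denominators_pos ha0 ha hq2 hq1 hq
  have hqpos (n : ℕ) : 0 < q n := (hqnn n).1
  have hq0 : q 0 = 1 := by
    have h := hq 0 le_rfl
    norm_num [ha0, hq2, hq1] at h
    exact h
  have hp0 : p 0 = 0 := by
    have h := hp 0 le_rfl
    norm_num [ha0, hp2, hp1] at h
    exact h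
  have hdet := convergents_det_sq hp2 hp1 hq2 hq1 hp hq m
  have hsucc := errors_mul_neg hirr ha hqpos hp hq hconv m
  have hpred : (q ((m : ℤ) - 1) * z - p ((m : ℤ) - 1)) * (q m * z - p m) < 0 := by
    cases m with
    | zero => simp [hq0, hp0, hq1, hp1, hz0]
    | succ k => simpa using errors_mul_neg hirr ha hqpos hp hq hconv k
  have hupper : (N : ℤ) < (b m + 1) * q m + q ((m : ℤ) - 1) := by
    rw [host, Finset.sum_range_succ]
    linarith [sum_digits_lt hq0 hq1 hqpos hq m fun j hj => (hb j hj.le).2]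
  have hqm := hqpos m
  have hqm' := (hqnn m).2
  have hbm' : (b m : ℝ) ≤ a (m + 1) := by exact_mod_cast (hb m le_rfl).2
  have hQ' : 0 ≤ b m * q m + q ((m : ℤ) - 1) := by positivity
  have hdet' : (q m * (b m * p m + p ((m : ℤ) - 1)) -
      p m * (b m * q m + q ((m : ℤ) - 1))) ^ 2 = 1 := by
    linear_combination hdet
  have e1 := hq (m + 1) (by positivity)
  have e2 := hp (m + 1) (by positivity)
  rw [show (m : ℤ) + 1 - 1 = m by ring, show (m : ℤ) + 1 - 2 = m - 1 by ring] at e1 e2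
  rw [e1, e2] at hsucc
  push_cast at hsucc
  suffices h : b m * q m + q ((m : ℤ) - 1) ≤ N →
      (b m * q m + q ((m : ℤ) - 1) < N → (gapValues (kroneckerPts z N)).card = 3) ∧
      (b m * q m + q ((m : ℤ) - 1) = N → (gapValues (kroneckerPts z N)).card = 2) from
    ⟨fun hN => (h hN.ge).2 hN.symm, fun hN => (h hN.le).1 hN⟩
  intro hle
  rcases lt_or_ge 0 (q m * z - p m : ℝ) with hd | hd
  · have hsucc' := neg_of_mul_neg_right hsucc hd.le
    have hmul := mul_le_mul_of_nonneg_right hbm' hd.le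
    have h := card_gapValues_kroneckerPts (N := N) hirr (Q := q m) (P := p m)
      (Q' := b m * q m + q ((m : ℤ) - 1)) (P' := b m * p m + p ((m : ℤ) - 1))
      hd (by push_cast; linarith) hdet' hqm.le hQ' (by lia) hle (by linarith)
    exact ⟨h.1 (by lia), h.2.1 (by lia)⟩
  · have hsucc' := pos_of_mul_neg_right hsucc hd
    have hd' : (q m * z - p m : ℝ) < 0 := hd.lt_of_ne fun h0 => by simp [h0] at hpred
    have hmul := mul_le_mul_of_nonpos_right hbm' hd
    have h := card_gapValues_kroneckerPts (N := N) hirr (Q' := q m) (P' := p m)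
      (Q := b m * q m + q ((m : ℤ) - 1)) (P := b m * p m + p ((m : ℤ) - 1))
      (by push_cast; linarith) (by linarith) (by linear_combination hdet) hQ' hqm.le hle (by lia)
      (by linarith)
    exact ⟨fun h1 => h.1 h1 (by lia), fun h1 => h.2.2 h1 (by lia)⟩
end

section
/- The new point splits a longest gap: for every irrational z ∈ (0,1) and every N ≥ 2, the point {Nz} does not belong to P_N and lies strictly inside a gap of P_N of maximal length; moreover it subdivides this gap into two arcs, one of which has length equal to the minimal gap length of P_N (so the gaps of P_{N+1} are those of P_N with one maximal gap replaced by a minimal-length gap and the complementary piece). -/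
open Finset Filter

section Gaps

variable {S : Finset ℝ} {x : ℝ}

theorem add_gapOf_le_one (hS : ∀ y ∈ S, y < 1) : x + gapOf S x ≤ 1 := by
  unfold gapOf
  split_ifs with h
  · have := hS _ (mem_of_mem_filter _ (min'_mem _ h))
    linarith
  · linarith

/-- A gap is at most the counterclockwise arc from its left endpoint to any other point. -/
theorem gapOf_le_fract_sub (h0 : ∀ y ∈ S, 0 ≤ y) (h1 : ∀ y ∈ S, y < 1) (hx : x ∈ S)
    {y : ℝ} (hy : y ∈ S) (hyx : y ≠ x) : gapOf S x ≤ Int.fract (y - x) := by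
  have hy0 := h0 y hy
  have hy1 := h1 y hy
  have hx0 := h0 x hx
  have hx1 := h1 x hx
  rcases lt_or_gt_of_ne hyx with hlt | hgt
  · have hfr : Int.fract (y - x) = y - x + 1 := by
      rw [← Int.fract_add_one, Int.fract_eq_self.2 ⟨by linarith, by linarith⟩]
    have := add_gapOf_le_one (x := x) h1
    linarith
  · rw [Int.fract_eq_self.2 ⟨by linarith, by linarith⟩]
    have hmem : y ∈ S.filter fun y => x < y := mem_filter.2 ⟨hy, hgt⟩
    unfold gapOf
    rw [dif_pos ⟨y, by convert hmem⟩]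
    have := min'_le _ y hmem
    gcongr

/-- A lower bound for all counterclockwise arcs from `x` to other points bounds the gap at `x`. -/
theorem le_gapOf (h0 : ∀ y ∈ S, 0 ≤ y) (h1 : ∀ y ∈ S, y < 1) (hzero : 0 ∈ S) (hx : x ∈ S)
    (hne : ∃ y ∈ S, y ≠ x) {δ : ℝ} (hδ : ∀ y ∈ S, y ≠ x → δ ≤ Int.fract (y - x)) :
    δ ≤ gapOf S x := by
  have hx0 := h0 x hx
  have hx1 := h1 x hx
  unfold gapOf
  split_ifs with h
  · obtain ⟨hS, hlt⟩ := mem_filter.1 (min'_mem _ h)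
    have hle := hδ _ hS hlt.ne'
    rwa [Int.fract_eq_self.2 ⟨by linarith, by linarith [h1 _ hS]⟩] at hle
  · have hmax : ∀ y ∈ S, y ≤ x := fun y hy => by
      by_contra hlt
      exact h ⟨y, mem_filter.2 ⟨hy, not_le.1 hlt⟩⟩
    obtain ⟨y, hy, hyx⟩ := hne
    have hxpos : 0 < x := (h0 y hy).trans_lt (lt_of_le_of_ne (hmax y hy) hyx)
    have hle := hδ 0 hzero hxpos.ne
    rw [← Int.fract_add_one, Int.fract_eq_self.2 ⟨by linarith, by linarith⟩] at hle
    linarith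

end Gaps

/-- The fractional part of an integer multiple of `z`. -/
noncomputable def fractMul (z : ℝ) (k : ℤ) : ℝ := Int.fract ((k : ℝ) * z)

section FractMul

variable {z : ℝ}

theorem fractMul_nonneg (k : ℤ) : 0 ≤ fractMul z k := Int.fract_nonneg _

theorem fractMul_lt_one (k : ℤ) : fractMul z k < 1 := Int.fract_lt_one _

theorem fractMul_zero : fractMul z 0 = 0 := by simp [fractMul]

theorem fractMul_pos (hz : Irrational z) {k : ℤ} (hk : k ≠ 0) : 0 < fractMul z k := by
  refine Int.fract_pos.2 fun h => ?_
  exact (hz.intCast_mul hk).ne_int _ h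

theorem fractMul_neg (hz : Irrational z) {k : ℤ} (hk : k ≠ 0) :
    fractMul z (-k) = 1 - fractMul z k := by
  have := fractMul_pos hz hk
  unfold fractMul at *
  rw [Int.cast_neg, neg_mul, Int.fract_neg this.ne']

theorem fract_fractMul_sub (k l : ℤ) :
    Int.fract (fractMul z k - fractMul z l) = fractMul z (k - l) := by
  unfold fractMul
  rw [Int.fract_eq_fract]
  refine ⟨⌊(l : ℝ) * z⌋ - ⌊(k : ℝ) * z⌋, ?_⟩
  simp only [Int.fract]
  push_cast
  ring

theorem fractMul_add (k l : ℤ) : fractMul z (k + l) = fractMul z k + fractMul z l ∨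
    fractMul z (k + l) = fractMul z k + fractMul z l - 1 := by
  have h : Int.fract (fractMul z k + fractMul z l) = fractMul z (k + l) := by
    unfold fractMul
    rw [Int.fract_eq_fract]
    refine ⟨-⌊(l : ℝ) * z⌋ - ⌊(k : ℝ) * z⌋, ?_⟩
    simp only [Int.fract]
    push_cast
    ring
  have hk := fractMul_nonneg (z := z) k
  have hl := fractMul_nonneg (z := z) l
  have hk1 := fractMul_lt_one (z := z) k
  have hl1 := fractMul_lt_one (z := z) l
  rw [← h]
  by_cases hlt : fractMul z k + fractMul z l < 1
  · exact Or.inl (Int.fract_eq_self.2 ⟨by linarith, hlt⟩)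
  · right
    rw [← Int.fract_sub_one, Int.fract_eq_self.2 ⟨by linarith, by linarith⟩]

theorem fractMul_injective (hz : Irrational z) : Function.Injective (fractMul z) := by
  intro k l h
  by_contra hne
  have := fractMul_pos hz (sub_ne_zero.2 hne)
  rw [← fract_fractMul_sub, h, sub_self, Int.fract_zero] at this
  exact this.false

end FractMul

section KroneckerPts

variable {z : ℝ} {N : ℕ}

theorem mem_kroneckerPts_iff {x : ℝ} :
    x ∈ kroneckerPts z N ↔ ∃ k : ℤ, 0 ≤ k ∧ k < N ∧ fractMul z k = x := by
  simp only [kroneckerPts, mem_image, Finset.mem_range, fractMul]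
  constructor
  · rintro ⟨n, hn, rfl⟩
    exact ⟨n, by lia, by lia, by simp⟩
  · rintro ⟨k, hk0, hkN, rfl⟩
    lift k to ℕ using hk0
    exact ⟨k, by lia, by simp⟩

theorem nonneg_of_mem_kroneckerPts : ∀ y ∈ kroneckerPts z N, 0 ≤ y := fun y hy => by
  obtain ⟨k, -, -, rfl⟩ := mem_kroneckerPts_iff.1 hy
  exact fractMul_nonneg k

theorem lt_one_of_mem_kroneckerPts : ∀ y ∈ kroneckerPts z N, y < 1 := fun y hy => by
  obtain ⟨k, -, -, rfl⟩ := mem_kroneckerPts_iff.1 hy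
  exact fractMul_lt_one k

theorem gapOf_kroneckerPts_le (hz : Irrational z) {k l : ℤ} (hk0 : 0 ≤ k) (hkN : k < N)
    (hl0 : 0 ≤ l) (hlN : l < N) (hne : l ≠ k) :
    gapOf (kroneckerPts z N) (fractMul z k) ≤ fractMul z (l - k) := by
  rw [← fract_fractMul_sub]
  exact gapOf_le_fract_sub nonneg_of_mem_kroneckerPts lt_one_of_mem_kroneckerPts
    (mem_kroneckerPts_iff.2 ⟨k, hk0, hkN, rfl⟩) (mem_kroneckerPts_iff.2 ⟨l, hl0, hlN, rfl⟩)
    ((fractMul_injective hz).ne hne)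

theorem le_gapOf_kroneckerPts (hz : Irrational z) (hN : 2 ≤ N) {k : ℤ} (hk0 : 0 ≤ k)
    (hkN : k < N) {δ : ℝ}
    (hδ : ∀ l : ℤ, 0 ≤ l → l < N → l ≠ k → δ ≤ fractMul z (l - k)) :
    δ ≤ gapOf (kroneckerPts z N) (fractMul z k) := by
  refine le_gapOf nonneg_of_mem_kroneckerPts lt_one_of_mem_kroneckerPts
    (mem_kroneckerPts_iff.2 ⟨0, le_rfl, by lia, fractMul_zero⟩)
    (mem_kroneckerPts_iff.2 ⟨k, hk0, hkN, rfl⟩) ?_ fun y hy hyk => ?_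
  · obtain ⟨l, hl0, hlN, hl⟩ : ∃ l : ℤ, 0 ≤ l ∧ l < N ∧ l ≠ k := by
      by_cases h : k = 0
      · exact ⟨1, by lia, by lia, by lia⟩
      · exact ⟨0, by lia, by lia, by lia⟩
    exact ⟨_, mem_kroneckerPts_iff.2 ⟨l, hl0, hlN, rfl⟩, (fractMul_injective hz).ne hl⟩
  · obtain ⟨l, hl0, hlN, rfl⟩ := mem_kroneckerPts_iff.1 hy
    rw [fract_fractMul_sub]
    exact hδ l hl0 hlN fun h => hyk (h ▸ rfl)

/-- The first `N` multiples of `z` come closest to `0` from above at the index `a` and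
from below at the index `b`. -/
structure IsExtremalPair (z : ℝ) (N : ℕ) (a b : ℤ) : Prop where
  a_pos : 0 < a
  a_lt : a < N
  b_pos : 0 < b
  b_lt : b < N
  le_fractMul : ∀ k : ℤ, 0 < k → k < N → fractMul z a ≤ fractMul z k
  fractMul_le : ∀ k : ℤ, 0 < k → k < N → fractMul z k ≤ fractMul z b

theorem exists_isExtremalPair (z : ℝ) (hN : 2 ≤ N) : ∃ a b, IsExtremalPair z N a b := by
  have hne : (Finset.Ioo (0 : ℤ) N).Nonempty := ⟨1, Finset.mem_Ioo.2 ⟨by lia, by lia⟩⟩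
  obtain ⟨a, ha, hamin⟩ := exists_min_image _ (fractMul z) hne
  obtain ⟨b, hb, hbmax⟩ := exists_max_image _ (fractMul z) hne
  rw [Finset.mem_Ioo] at ha hb
  exact ⟨a, b, ha.1, ha.2, hb.1, hb.2, fun k h0 hk => hamin k (Finset.mem_Ioo.2 ⟨h0, hk⟩),
    fun k h0 hk => hbmax k (Finset.mem_Ioo.2 ⟨h0, hk⟩)⟩

namespace IsExtremalPair

variable {a b : ℤ}

theorem le_add (h : IsExtremalPair z N a b) (hz : Irrational z) : (N : ℤ) ≤ a + b := by
  by_contra! hlt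
  have ha := h.a_pos
  have hb := h.b_pos
  have h1 := h.le_fractMul (a + b) (by lia) hlt
  have h2 := h.fractMul_le (a + b) (by lia) hlt
  have hapos := fractMul_pos hz ha.ne'
  have hb1 := fractMul_lt_one (z := z) b
  rcases fractMul_add (z := z) a b with h3 | h3 <;> linarith

theorem min_le_gapOf (h : IsExtremalPair z N a b) (hz : Irrational z) (hN : 2 ≤ N) {k : ℤ}
    (hk0 : 0 ≤ k) (hkN : k < N) : min (fractMul z a) (1 - fractMul z b) ≤
      gapOf (kroneckerPts z N) (fractMul z k) := by
  refine le_gapOf_kroneckerPts hz hN hk0 hkN fun l hl0 hlN hlk => ?_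
  rcases lt_or_gt_of_ne hlk with hlt | hgt
  · refine (min_le_right _ _).trans ?_
    have h1 := h.fractMul_le (k - l) (by lia) (by lia)
    rw [← neg_sub k l, fractMul_neg hz (by lia)]
    linarith
  · exact (min_le_left _ _).trans (h.le_fractMul _ (by lia) (by lia))

theorem gapOf_le_left (h : IsExtremalPair z N a b) (hz : Irrational z) {k : ℤ}
    (hk0 : 0 ≤ k) (hkN : k + a < N) :
    gapOf (kroneckerPts z N) (fractMul z k) ≤ fractMul z a := by
  have ha := h.a_pos
  have := gapOf_kroneckerPts_le hz (k := k) (l := k + a) hk0 (by lia) (by lia) hkN (by lia)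
  rwa [add_sub_cancel_left] at this

theorem gapOf_le_right (h : IsExtremalPair z N a b) (hz : Irrational z) {k : ℤ}
    (hk0 : b ≤ k) (hkN : k < N) :
    gapOf (kroneckerPts z N) (fractMul z k) ≤ 1 - fractMul z b := by
  have hb := h.b_pos
  have := gapOf_kroneckerPts_le hz (k := k) (l := k - b) (by lia) hkN (by lia) (by lia) (by lia)
  rwa [sub_sub_cancel_left, fractMul_neg hz hb.ne'] at this

theorem gapOf_le_add (h : IsExtremalPair z N a b) (hz : Irrational z) {k : ℤ}
    (hk0 : 0 ≤ k) (hkN : k < N) :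
    gapOf (kroneckerPts z N) (fractMul z k) ≤ fractMul z a + (1 - fractMul z b) := by
  have ha0 := fractMul_nonneg (z := z) a
  have hb1 := fractMul_lt_one (z := z) b
  have hb := h.b_pos
  have haN := h.a_lt
  have hbN := h.b_lt
  by_cases hka : k + a < N
  · linarith [h.gapOf_le_left hz hk0 hka]
  by_cases hbk : b ≤ k
  · linarith [h.gapOf_le_right hz hbk hkN]
  have hne : a ≠ b := by
    rintro rfl
    have hone := fractMul_injective hz
      ((h.le_fractMul 1 (by lia) (by lia)).antisymm (h.fractMul_le 1 (by lia) (by lia)))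
    have hlast := fractMul_injective hz
      ((h.le_fractMul (N - 1) (by lia) (by lia)).antisymm
        (h.fractMul_le (N - 1) (by lia) (by lia)))
    lia
  have h1 := gapOf_kroneckerPts_le hz (k := k) (l := k + a - b) hk0 hkN (by lia) (by lia) (by lia)
  rw [show k + a - b - k = a + -b by ring] at h1
  have h2 := fractMul_neg hz hb.ne'
  rcases fractMul_add (z := z) a (-b) with h3 | h3 <;> linarith

theorem le_gapOf_zero (h : IsExtremalPair z N a b) (hz : Irrational z) (hN : 2 ≤ N) :
    fractMul z a ≤ gapOf (kroneckerPts z N) (fractMul z 0) :=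
  le_gapOf_kroneckerPts hz hN le_rfl (by lia) fun l hl0 hlN hl =>
    h.le_fractMul _ (by lia) (by lia)

theorem le_gapOf_right (h : IsExtremalPair z N a b) (hz : Irrational z) (hN : 2 ≤ N) :
    1 - fractMul z b ≤ gapOf (kroneckerPts z N) (fractMul z b) := by
  have hb := h.b_pos
  have hb1 := fractMul_lt_one (z := z) b
  refine le_gapOf_kroneckerPts hz hN hb.le h.b_lt fun l hl0 hlN hl => ?_
  rcases lt_or_gt_of_ne hl with hlt | hgt
  · have h1 := h.fractMul_le (b - l) (by lia) (by have := h.b_lt; lia)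
    rw [← neg_sub b l, fractMul_neg hz (by lia)]
    linarith
  · have h1 := h.fractMul_le l (by lia) hlN
    have h2 := fractMul_pos hz (sub_ne_zero.2 hl)
    have h3 := fractMul_add (z := z) (l - b) b
    rw [sub_add_cancel] at h3
    have h4 := fractMul_nonneg (z := z) l
    rcases h3 with h3 | h3 <;> linarith

theorem add_le_gapOf (h : IsExtremalPair z N a b) (hz : Irrational z) (hN : 2 ≤ N)
    (hlt : (N : ℤ) < a + b) : fractMul z a + (1 - fractMul z b) ≤
      gapOf (kroneckerPts z N) (fractMul z (N - a)) := by
  have ha := h.a_pos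
  have haN := h.a_lt
  have hbN := h.b_lt
  refine le_gapOf_kroneckerPts hz hN (by lia) (by lia) fun l hl0 hlN hl => ?_
  obtain ⟨k, rfl⟩ : ∃ k, l = (N - a) + k := ⟨l - (N - a), by ring⟩
  rw [add_sub_cancel_left]
  have hk1 := fractMul_lt_one (z := z) k
  have hapos := fractMul_pos hz ha.ne'
  have hb1 := fractMul_lt_one (z := z) b
  rcases lt_or_gt_of_ne (show k ≠ 0 by lia) with hk | hk
  · have h1 := h.le_fractMul (b + k) (by lia) (by lia)
    have h2 := h.fractMul_le (-k) (by lia) (by lia)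
    rw [fractMul_neg hz hk.ne] at h2
    rcases fractMul_add (z := z) b k with h3 | h3
    · linarith [fractMul_lt_one (z := z) (b + k)]
    · linarith
  · have h1 := h.fractMul_le (a - k) (by lia) (by lia)
    have h2 := h.le_fractMul k hk (by lia)
    have h4 := fractMul_pos hz (show a - k ≠ 0 by lia)
    have h3 := fractMul_add (z := z) (a - k) k
    rw [sub_add_cancel] at h3
    rcases h3 with h3 | h3 <;> linarith

theorem isLeast_gaps (h : IsExtremalPair z N a b) (hz : Irrational z) (hN : 2 ≤ N) :
    IsLeast {d : ℝ | ∃ y ∈ kroneckerPts z N, gapOf (kroneckerPts z N) y = d}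
      (min (fractMul z a) (1 - fractMul z b)) := by
  constructor
  · rcases min_choice (fractMul z a) (1 - fractMul z b) with hm | hm <;> rw [hm]
    · exact ⟨_, mem_kroneckerPts_iff.2 ⟨0, le_rfl, by lia, rfl⟩,
        (h.gapOf_le_left hz le_rfl (by simpa using h.a_lt)).antisymm (h.le_gapOf_zero hz hN)⟩
    · exact ⟨_, mem_kroneckerPts_iff.2 ⟨b, h.b_pos.le, h.b_lt, rfl⟩,
        (h.gapOf_le_right hz le_rfl h.b_lt).antisymm (h.le_gapOf_right hz hN)⟩
  · rintro _ ⟨y, hy, rfl⟩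
    obtain ⟨k, hk0, hkN, rfl⟩ := mem_kroneckerPts_iff.1 hy
    exact h.min_le_gapOf hz hN hk0 hkN

theorem gapOf_le_max (h : IsExtremalPair z N a b) (hz : Irrational z)
    (hab : (N : ℤ) = a + b) {k : ℤ} (hk0 : 0 ≤ k) (hkN : k < N) :
    gapOf (kroneckerPts z N) (fractMul z k) ≤ max (fractMul z a) (1 - fractMul z b) := by
  by_cases hbk : b ≤ k
  · exact (h.gapOf_le_right hz hbk hkN).trans (le_max_right _ _)
  · exact (h.gapOf_le_left hz hk0 (by lia)).trans (le_max_left _ _)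

/-- Some longest gap is split by the next point, with a piece of minimal length. -/
theorem exists_split (h : IsExtremalPair z N a b) (hz : Irrational z) (hN : 2 ≤ N) :
    ∃ k : ℤ, 0 ≤ k ∧ k < N ∧
      (∀ l : ℤ, 0 ≤ l → l < N → gapOf (kroneckerPts z N) (fractMul z l) ≤
        gapOf (kroneckerPts z N) (fractMul z k)) ∧
      fractMul z k < fractMul z N ∧
      fractMul z N < fractMul z k + gapOf (kroneckerPts z N) (fractMul z k) ∧
      (fractMul z N - fractMul z k = min (fractMul z a) (1 - fractMul z b) ∨
        fractMul z k + gapOf (kroneckerPts z N) (fractMul z k) - fractMul z N =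
          min (fractMul z a) (1 - fractMul z b)) := by
  have ha := h.a_pos
  have haN := h.a_lt
  have hb := h.b_pos
  have hbN := h.b_lt
  have hapos := fractMul_pos hz ha.ne'
  have hb1 := fractMul_lt_one (z := z) b
  have hNpos := fractMul_pos hz (show (N : ℤ) ≠ 0 by lia)
  have hN1 := fractMul_lt_one (z := z) N
  rcases (h.le_add hz).lt_or_eq with hlt | hab
  · have hle := h.add_le_gapOf hz hN hlt
    have hgap := hle.antisymm' (h.gapOf_le_add hz (k := N - a) (by lia) (by lia))
    have hone := add_gapOf_le_one (x := fractMul z (N - a))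
      (lt_one_of_mem_kroneckerPts (z := z) (N := N))
    have hsum := fractMul_add (z := z) (N - a) a
    rw [sub_add_cancel] at hsum
    have hsum : fractMul z N = fractMul z (N - a) + fractMul z a := by
      rcases hsum with h3 | h3 <;> linarith
    refine ⟨N - a, by lia, by lia, fun l hl0 hlN => ?_, by linarith, by linarith, ?_⟩
    · exact (h.gapOf_le_add hz hl0 hlN).trans hle
    · rw [hgap, hsum]
      rcases min_choice (fractMul z a) (1 - fractMul z b) with hm | hm <;> rw [hm]
      · left; ring
      · right; ring
  · have hsum := fractMul_add (z := z) a b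
    rw [← hab] at hsum
    rcases lt_or_ge (fractMul z a) (1 - fractMul z b) with hcmp | hcmp
    · have hgap := (h.le_gapOf_right hz hN).antisymm' (h.gapOf_le_right hz le_rfl hbN)
      have hsum : fractMul z N = fractMul z a + fractMul z b := by
        rcases hsum with h3 | h3 <;> linarith
      refine ⟨b, hb.le, hbN, fun l hl0 hlN => ?_, by linarith, by linarith, Or.inl ?_⟩
      · rw [hgap, ← max_eq_right hcmp.le]
        exact h.gapOf_le_max hz hab hl0 hlN
      · rw [min_eq_left hcmp.le]; linarith
    · have hgap := (h.le_gapOf_zero hz hN).antisymm'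
        (h.gapOf_le_left hz le_rfl (by simpa using haN))
      have hsum : fractMul z N = fractMul z a + fractMul z b - 1 := by
        rcases hsum with h3 | h3 <;> linarith
      have hzero := fractMul_zero (z := z)
      refine ⟨0, le_rfl, by lia, fun l hl0 hlN => ?_, by linarith, by linarith, Or.inr ?_⟩
      · rw [hgap, ← max_eq_left hcmp]
        exact h.gapOf_le_max hz hab hl0 hlN
      · rw [min_eq_right hcmp]; linarith

end IsExtremalPair

end KroneckerPts

/-- **The new point splits a longest gap.** For every irrational `z ∈ (0,1)` and every
`N ≥ 2`, the point `{N z}` does not belong to `P_N` and lies strictly inside a gap of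
`P_N` of maximal length; moreover it subdivides this gap into two arcs, one of which
has length equal to the minimal gap length of `P_N`. -/
theorem new_point_splits_longest_gap
    (z : ℝ) (hirr : Irrational z) (hz0 : 0 < z) (hz1 : z < 1)
    (N : ℕ) (hN2 : 2 ≤ N) :
    Int.fract (N * z) ∉ kroneckerPts z N ∧
    ∃ x ∈ kroneckerPts z N,
      (∀ y ∈ kroneckerPts z N,
          gapOf (kroneckerPts z N) y ≤ gapOf (kroneckerPts z N) x) ∧
      x < Int.fract (N * z) ∧
      Int.fract (N * z) < x + gapOf (kroneckerPts z N) x ∧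
      ∃ μ : ℝ, IsLeast {d : ℝ | ∃ y ∈ kroneckerPts z N, gapOf (kroneckerPts z N) y = d} μ ∧
        (Int.fract (N * z) - x = μ ∨ x + gapOf (kroneckerPts z N) x - Int.fract (N * z) = μ) := by
  have hcast : Int.fract ((N : ℝ) * z) = fractMul z N := by simp [fractMul]
  rw [hcast]
  obtain ⟨a, b, h⟩ := exists_isExtremalPair z hN2
  obtain ⟨k, hk0, hkN, hmax, hlt, hgt, hmin⟩ := h.exists_split hirr hN2
  refine ⟨fun hmem => ?_, _, mem_kroneckerPts_iff.2 ⟨k, hk0, hkN, rfl⟩, fun y hy => ?_, hlt, hgt,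
    _, h.isLeast_gaps hirr hN2, hmin⟩
  · obtain ⟨l, -, hlN, hl⟩ := mem_kroneckerPts_iff.1 hmem
    exact hlN.ne (fractMul_injective hirr hl)
  · obtain ⟨l, hl0, hlN, rfl⟩ := mem_kroneckerPts_iff.1 hy
    exact hmax l hl0 hlN
end
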